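/- (Extended dual Lovász Lemma.) Let Λ be a family of n pseudoplanes in general position in ℝ³ and let k be a nonnegative integer. Let γ₀ be the bi-infinite x-monotone curve {(x, u(x), v(x)) : x ∈ ℝ}, where u, v : ℝ → ℝ are continuous, and assume that (1) γ₀ intersects each pseudoplane a ∈ Λ in exactly one point (there is exactly one x with v(x) = a(x, u(x))), and (2) the xy-projection of γ₀ intersects the xy-projection of every intersection curve γ_{a,b} at most once (for each pair of distinct a,b ∈ Λ there is at most one x with u(x) = φ_{a,b}(x)). Then γ₀ is fully contained in at most n(n−1)/2 corridors of C^k. -/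

import Mathlib

open scoped Classical

noncomputable section

/-- A pseudoplane, identified with the total bivariate (curried) function whose graph it is. -/
abbrev PP : Type := ℝ → ℝ → ℝ

/-- `φ : ℝ → ℝ` is the continuous function whose graph is the xy-projection of the
intersection curve `γ_{a,b} = a ∩ b` of the pseudoplanes `a` and `b`. -/
def IsGraphFun (a b : PP) (φ : ℝ → ℝ) : Prop :=
  Continuous φ ∧ ∀ x y : ℝ, a x y = b x y ↔ y = φ x

/-- A family of pseudoplanes in general position in ℝ³:
(1) each member is (the graph of) a continuous total bivariate function;
(2) the intersection of any two distinct members is the graph of a continuous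
    function `φ_{a,b} : ℝ → ℝ` (a connected x-monotone unbounded curve);
(3) any three distinct members intersect in exactly one point;
(4) the xy-projections of the intersection curves form a family of pseudolines:
    for distinct pairs `{a,b} ≠ {c,d}`, `φ_{a,b}` and `φ_{c,d}` agree at exactly one point;
(5) no point is incident to more than three pseudoplanes;
(6) no two pseudoplanes are tangent (the difference changes sign);
(7) no intersection curve of two pseudoplanes is tangent to a third pseudoplane
    (the relevant difference function takes both signs). -/
def PseudoplaneFamily (Λ : Finset PP) : Prop :=
  (∀ a ∈ Λ, Continuous fun q : ℝ × ℝ => a q.1 q.2) ∧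
  (∀ a ∈ Λ, ∀ b ∈ Λ, a ≠ b → ∃ φ : ℝ → ℝ, IsGraphFun a b φ) ∧
  (∀ a ∈ Λ, ∀ b ∈ Λ, ∀ c ∈ Λ, a ≠ b → a ≠ c → b ≠ c →
    ∃! q : ℝ × ℝ, a q.1 q.2 = b q.1 q.2 ∧ a q.1 q.2 = c q.1 q.2) ∧
  (∀ a ∈ Λ, ∀ b ∈ Λ, ∀ c ∈ Λ, ∀ d ∈ Λ, a ≠ b → c ≠ d → ({a, b} : Finset PP) ≠ {c, d} →
    ∀ φ ψ : ℝ → ℝ, IsGraphFun a b φ → IsGraphFun c d ψ → ∃! x : ℝ, φ x = ψ x) ∧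
  (∀ a ∈ Λ, ∀ b ∈ Λ, ∀ c ∈ Λ, ∀ d ∈ Λ, a ≠ b → a ≠ c → a ≠ d → b ≠ c → b ≠ d → c ≠ d →
    ¬ ∃ x y : ℝ, a x y = b x y ∧ a x y = c x y ∧ a x y = d x y) ∧
  (∀ a ∈ Λ, ∀ b ∈ Λ, a ≠ b → (∃ x y : ℝ, a x y < b x y) ∧ (∃ x y : ℝ, b x y < a x y)) ∧
  (∀ a ∈ Λ, ∀ b ∈ Λ, ∀ c ∈ Λ, a ≠ b → a ≠ c → b ≠ c → ∀ φ : ℝ → ℝ, IsGraphFun a b φ →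
    (∃ x : ℝ, c x (φ x) < a x (φ x)) ∧ (∃ x : ℝ, a x (φ x) < c x (φ x)))

/-- The level of the point `(x, y, z)`: the number of members of `Λ` passing strictly below it. -/
def level (Λ : Finset PP) (x y z : ℝ) : ℕ :=
  (Λ.filter fun a => a x y < z).card

/-- The triple `s = {a,b,c}` spans a `k`-corridor: its common (triple intersection) point
is at level `k`. -/
def IsKCorridorTriple (Λ : Finset PP) (k : ℕ) (s : Finset PP) : Prop :=
  ∃ x y z : ℝ, (∀ a ∈ s, a x y = z) ∧ level Λ x y z = k

/-- The set `C^k` of `k`-corridors, encoded by the 3-element subsets of `Λ` spanning them. -/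
def kCorridors (Λ : Finset PP) (k : ℕ) : Finset (Finset PP) :=
  (Λ.powersetCard 3).filter (IsKCorridorTriple Λ k)

/-- The corridor of a triple `s`: the open region strictly between the lower and the upper
envelope of the three surfaces in `s`. Points of ℝ³ are `(x, (y, z))`. -/
def corridorSet (s : Finset PP) : Set (ℝ × ℝ × ℝ) :=
  {p | (∃ a ∈ s, a p.1 p.2.1 < p.2.2) ∧ (∃ a ∈ s, p.2.2 < a p.1 p.2.1)}

/-- The common intersection curve of the members of `s`. -/
def curveSet (s : Finset PP) : Set (ℝ × ℝ × ℝ) :=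
  {p | ∀ a ∈ s, a p.1 p.2.1 = p.2.2}

/-- The corridor spanned by `s₁` is immersed in the corridor spanned by `s₂`: they share
exactly one pseudoplane, and the intersection curve of the other two pseudoplanes of `s₁`
is fully contained in the corridor of `s₂`. -/
def Immersed (s₁ s₂ : Finset PP) : Prop :=
  (s₁ ∩ s₂).card = 1 ∧ curveSet (s₁ \ s₂) ⊆ corridorSet s₂

/-- `X^k`: the number of ordered pairs of `k`-corridors such that the first is immersed
in the second. -/
def numImmersedPairs (Λ : Finset PP) (k : ℕ) : ℕ :=
  ((kCorridors Λ k ×ˢ kCorridors Λ k).filter fun q => Immersed q.1 q.2).card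

/-- The level at the crossing `c`. -/
theorem comb_tele {S' : Type} (S : Finset S') (x : S' → ℝ) (e : S' → ℤ) (k : ℕ)
    (hx : ∀ c ∈ S, ∀ d ∈ S, x c = x d → c = d)
    (he : ∀ c ∈ S, e c = 1 ∨ e c = -1)
    (lev : S' → ℕ)
    (hlev : ∀ c ∈ S, lev c = (S.filter fun d => (x d < x c ∧ e d = -1) ∨ (x c < x d ∧ e d = 1)).card)
    (F : Finset S') (hF : F ⊆ S) (hd : ∀ d ∈ S, ∀ c ∈ F, x d ≤ x c → d ∈ F) :
    (∑ c ∈ F, if lev c = k then e c else 0) =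
      (if k < (S.filter fun d => e d = 1).card then 1 else 0) -
      (if k < (S.filter fun d => (d ∈ F ∧ e d = -1) ∨ (d ∉ F ∧ e d = 1)).card then 1 else 0) := by
  induction F using Finset.induction_on_max_value x with
  | empty => simp
  | insert c F hc hmax ih =>
    have hcS : c ∈ S := hF (Finset.mem_insert_self _ _)
    have hFS : F ⊆ S := fun d hdF => hF (Finset.mem_insert_of_mem hdF)
    have hlt : ∀ d ∈ F, x d < x c := by
      intro d hdF
      refine lt_of_le_of_ne (hmax d hdF) ?_
      intro h
      exact hc (hx d (hFS hdF) c hcS h ▸ hdF)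
    have hiff : ∀ d ∈ S, d ∈ F ↔ x d < x c := by
      intro d hdS
      refine ⟨hlt d, fun h => ?_⟩
      have := hd d hdS c (Finset.mem_insert_self _ _) h.le
      rcases Finset.mem_insert.1 this with h' | h'
      · subst h'; exact absurd h (lt_irrefl _)
      · exact h'
    have ih' := ih hFS (by
      intro d hdS c' hc' hle
      rw [hiff d hdS]
      exact lt_of_le_of_lt hle (hlt c' hc'))
    rw [Finset.sum_insert hc, ih']
    have hne : ∀ d ∈ S, d ≠ c → x d ≠ x c := fun d hdS hdc h => hdc (hx d hdS c hcS h)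
    have hl := hlev c hcS
    have hgt : ∀ d ∈ S, d ∉ F → d ≠ c → x c < x d := by
      intro d hdS h1 h2
      rw [hiff d hdS] at h1
      exact lt_of_le_of_ne (not_lt.1 h1) (Ne.symm (hne d hdS h2))
    rcases he c hcS with h | h
    · have e1 : (S.filter fun d => (d ∈ F ∧ e d = -1) ∨ (d ∉ F ∧ e d = 1)).card = lev c + 1 := by
        rw [hl, ← Finset.card_insert_of_notMem (a := c)]
        · congr 1
          ext d
          simp only [Finset.mem_filter, Finset.mem_insert]
          constructor
          · rintro ⟨hdS, h1⟩
            by_cases hdc : d = c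
            · exact Or.inl hdc
            · right
              refine ⟨hdS, ?_⟩
              rcases h1 with ⟨h1, h2⟩ | ⟨h1, h2⟩
              · exact Or.inl ⟨hlt d h1, h2⟩
              · exact Or.inr ⟨hgt d hdS h1 hdc, h2⟩
          · rintro (rfl | ⟨hdS, h1⟩)
            · exact ⟨hcS, Or.inr ⟨hc, h⟩⟩
            · refine ⟨hdS, ?_⟩
              rw [hiff d hdS]
              rcases h1 with ⟨h1, h2⟩ | ⟨h1, h2⟩
              · exact Or.inl ⟨h1, h2⟩
              · exact Or.inr ⟨not_lt.2 h1.le, h2⟩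
        · simp
      have e2 : (S.filter fun d => (d ∈ insert c F ∧ e d = -1) ∨ (d ∉ insert c F ∧ e d = 1)).card
          = lev c := by
        rw [hl]
        congr 1
        ext d
        simp only [Finset.mem_filter, Finset.mem_insert, not_or]
        refine and_congr_right fun hdS => ?_
        by_cases hdc : d = c
        · subst hdc; simp [h]
        · have := hiff d hdS
          have := hgt d hdS
          have := hne d hdS hdc
          grind
      rw [e1, e2, h]
      split_ifs <;> omega
    · have e1 : (S.filter fun d => (d ∈ insert c F ∧ e d = -1) ∨ (d ∉ insert c F ∧ e d = 1)).card
          = lev c + 1 := by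
        rw [hl, ← Finset.card_insert_of_notMem (a := c)]
        · congr 1
          ext d
          simp only [Finset.mem_filter, Finset.mem_insert, not_or]
          by_cases hdc : d = c
          · subst hdc; simp [h, hcS]
          · have := hiff d
            have := hgt d
            have := hne d
            grind
        · simp
      have e2 : (S.filter fun d => (d ∈ F ∧ e d = -1) ∨ (d ∉ F ∧ e d = 1)).card = lev c := by
        rw [hl]
        congr 1
        ext d
        simp only [Finset.mem_filter]
        refine and_congr_right fun hdS => ?_
        by_cases hdc : d = c
        · subst hdc; simp [h, hc]
        · have := hiff d hdS
          have := hgt d hdS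
          have := hne d hdS hdc
          grind
      rw [e1, e2, h]
      split_ifs <;> omega

theorem comb_pair {S' : Type} (S : Finset S') (x : S' → ℝ) (e : S' → ℤ) (k : ℕ)
    (hx : ∀ c ∈ S, ∀ d ∈ S, x c = x d → c = d)
    (he : ∀ c ∈ S, e c = 1 ∨ e c = -1)
    (lev : S' → ℕ)
    (hlev : ∀ c ∈ S, lev c = (S.filter fun d => (x d < x c ∧ e d = -1) ∨ (x c < x d ∧ e d = 1)).card)
    (t : ℝ) (s : ℤ) (hs : s = 1 ∨ s = -1) (w : S' → ℤ)
    (hw1 : ∀ c ∈ S, x c < t → w c = - s * e c) (hw2 : ∀ c ∈ S, t < x c → w c = s * e c)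
    (hw3 : ∀ c ∈ S, x c = t → w c = 1) :
    ∑ c ∈ S.filter (fun c => lev c = k), w c ≤ 2 := by
  set F : Finset S' := S.filter fun c => x c < t ∨ (x c = t ∧ s * e c = -1) with hFdef
  have hFS : F ⊆ S := Finset.filter_subset _ _
  have hd : ∀ d ∈ S, ∀ c ∈ F, x d ≤ x c → d ∈ F := by
    intro d hdS c hc hle
    simp only [hFdef, Finset.mem_filter] at hc ⊢
    refine ⟨hdS, ?_⟩
    rcases hc with ⟨hcS, h | ⟨h, h'⟩⟩
    · exact Or.inl (lt_of_le_of_lt hle h)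
    · rcases lt_or_eq_of_le hle with h2 | h2
      · exact Or.inl (h ▸ h2)
      · have := hx d hdS c hcS h2
        subst this
        exact Or.inr ⟨h, h'⟩
  have A := comb_tele S x e k hx he lev hlev F hFS hd
  have B := comb_tele S x e k hx he lev hlev S (Finset.Subset.refl _) (fun d hdS _ _ _ => hdS)
  have C : ∑ c ∈ S.filter (fun c => lev c = k), w c =
      s * ((∑ c ∈ S, if lev c = k then e c else 0) - 2 * ∑ c ∈ F, if lev c = k then e c else 0) := by
    have : ∑ c ∈ F, (if lev c = k then e c else 0) =
        ∑ c ∈ S, if c ∈ F then (if lev c = k then e c else 0) else 0 := by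
      rw [Finset.sum_ite_mem, Finset.inter_eq_right.2 hFS]
    rw [this, Finset.sum_filter, Finset.mul_sum, ← Finset.sum_sub_distrib, Finset.mul_sum]
    refine Finset.sum_congr rfl fun c hc => ?_
    have m : c ∈ F ↔ x c < t ∨ (x c = t ∧ s * e c = -1) := by
      simp [hFdef, hc]
    by_cases hk : lev c = k
    · simp only [hk, if_true]
      rcases lt_trichotomy (x c) t with h | h | h
      · rw [if_pos (m.2 (Or.inl h)), hw1 c hc h]; ring
      · rw [hw3 c hc h]
        by_cases h' : s * e c = -1
        · rw [if_pos (m.2 (Or.inr ⟨h, h'⟩))]; linarith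
        · rw [if_neg (fun hh => by rcases m.1 hh with h1 | h1; exacts [absurd h1 (by linarith), h' h1.2])]
          rcases hs with rfl | rfl <;> rcases he c hc with h2 | h2 <;> rw [h2] at h' ⊢ <;> simp_all
      · rw [hw2 c hc h, if_neg (fun hh => by rcases m.1 hh with h1 | h1 <;> linarith)]; ring
    · simp [hk]
  rw [C, A, B]
  rcases hs with rfl | rfl <;> split_ifs <;> norm_num

/-- `f` and `g` are continuous and meet at most once, strictly between `-T` and `T`. -/
def Once (T : ℝ) (f g : ℝ → ℝ) : Prop :=
  Continuous f ∧ Continuous g ∧ (∀ x y, f x = g x → f y = g y → x = y) ∧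
    ∀ x, f x = g x → -T < x ∧ x < T

theorem Once.symm {T : ℝ} {f g : ℝ → ℝ} (h : Once T f g) : Once T g f :=
  ⟨h.2.1, h.1, fun x y hx hy => h.2.2.1 x y hx.symm hy.symm, fun x hx => h.2.2.2 x hx.symm⟩

theorem Once.neg {T : ℝ} {f g : ℝ → ℝ} (h : Once T f g) :
    Once T (fun x => - f x) (fun x => - g x) :=
  ⟨h.1.neg, h.2.1.neg, fun x y hx hy => h.2.2.1 x y (neg_injective hx) (neg_injective hy),
    fun x hx => h.2.2.2 x (neg_injective hx)⟩

/-- Intermediate value theorem for two functions. -/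
theorem ivt_two {f g : ℝ → ℝ} (hf : Continuous f) (hg : Continuous g) {x y : ℝ}
    (h1 : f x < g x) (h2 : g y < f y) : ∃ z, f z = g z ∧ ((x < z ∧ z < y) ∨ (y < z ∧ z < x)) := by
  have hc : ContinuousOn (fun z => f z - g z) (Set.uIcc x y) := (hf.sub hg).continuousOn
  have := intermediate_value_uIcc hc
  have h0 : (0 : ℝ) ∈ Set.uIcc (f x - g x) (f y - g y) := by
    rw [Set.mem_uIcc]; left; constructor <;> linarith
  obtain ⟨z, hz, hz0⟩ := this h0
  have hz0' : f z = g z := by simpa [sub_eq_zero] using hz0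
  have hzx : z ≠ x := by rintro rfl; linarith
  have hzy : z ≠ y := by rintro rfl; linarith
  refine ⟨z, hz0', ?_⟩
  rw [Set.mem_uIcc] at hz
  rcases hz with ⟨h3, h4⟩ | ⟨h3, h4⟩
  · exact Or.inl ⟨lt_of_le_of_ne h3 (Ne.symm hzx), lt_of_le_of_ne h4 hzy⟩
  · exact Or.inr ⟨lt_of_le_of_ne h3 (Ne.symm hzy), lt_of_le_of_ne h4 hzx⟩

theorem Once.s1 {T : ℝ} {f g : ℝ → ℝ} (h : Once T f g) {x0 : ℝ} (h0 : f x0 = g x0)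
    (hT : g (-T) < f (-T)) {x : ℝ} (hx : x < x0) : g x < f x := by
  by_contra hc
  rcases lt_or_eq_of_le (not_lt.1 hc) with h1 | h1
  · obtain ⟨z, hz, hz'⟩ := ivt_two h.1 h.2.1 h1 hT
    have := h.2.2.1 z x0 hz h0
    have := h.2.2.2 x0 h0
    rcases hz' with hz' | hz' <;> linarith
  · have := h.2.2.1 x x0 h1 h0; linarith

theorem Once.s2 {T : ℝ} {f g : ℝ → ℝ} (h : Once T f g) {x0 : ℝ} (h0 : f x0 = g x0)
    (hT : g T < f T) {x : ℝ} (hx : x0 < x) : g x < f x := by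
  by_contra hc
  rcases lt_or_eq_of_le (not_lt.1 hc) with h1 | h1
  · obtain ⟨z, hz, hz'⟩ := ivt_two h.1 h.2.1 h1 hT
    have := h.2.2.1 z x0 hz h0
    have := h.2.2.2 x0 h0
    rcases hz' with hz' | hz' <;> linarith
  · have := h.2.2.1 x x0 h1 h0; linarith

theorem Once.ne_T {T : ℝ} {f g : ℝ → ℝ} (h : Once T f g) : f T ≠ g T :=
  fun h0 => lt_irrefl _ (h.2.2.2 T h0).2

theorem Once.ne_nT {T : ℝ} {f g : ℝ → ℝ} (h : Once T f g) : f (-T) ≠ g (-T) :=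
  fun h0 => lt_irrefl _ (h.2.2.2 (-T) h0).1

theorem Once.le {T : ℝ} {f g : ℝ → ℝ} (h : Once T f g) (hS : g (-T) < f (-T)) (hT : g T < f T)
    (x : ℝ) : g x ≤ f x := by
  by_contra hc
  have hc := not_le.1 hc
  obtain ⟨z, hz, hz'⟩ := ivt_two h.1 h.2.1 hc hT
  rcases lt_trichotomy x z with h3 | h3 | h3
  · exact absurd (h.s1 hz hS h3) (not_lt.2 hc.le)
  · rw [h3] at hc; linarith
  · exact absurd (h.s2 hz hT h3) (not_lt.2 hc.le)

theorem Once.meet {T : ℝ} (hTp : 0 < T) {f g : ℝ → ℝ} (h : Once T f g) (hS : g (-T) < f (-T))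
    (hT : f T < g T) : ∃ t, f t = g t ∧ (∀ x, x < t → g x < f x) ∧ (∀ x, t < x → f x < g x) := by
  obtain ⟨z, hz, hz'⟩ := ivt_two h.1 h.2.1 hT hS
  exact ⟨z, hz, fun x hx => h.s1 hz hS hx, fun x hx => h.symm.s2 hz.symm hT hx⟩

/-- If `f` is above `g` at `-T` and below at some `z`, it stays below at `T`. -/
theorem Once.pass {T : ℝ} {f g : ℝ → ℝ} (h : Once T f g) (hS : g (-T) < f (-T)) {z : ℝ}
    (hz : f z < g z) : f T < g T := by
  rcases lt_trichotomy (f T) (g T) with h3 | h3 | h3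
  · exact h3
  · exact absurd h3 h.ne_T
  · exact absurd (h.le hS h3 z) (not_le.2 hz)

/-- If `f` is above `g` at `T` and below at some `z`, it is below at `-T`. -/
theorem Once.pass' {T : ℝ} {f g : ℝ → ℝ} (h : Once T f g) (hS : g T < f T) {z : ℝ}
    (hz : f z < g z) : f (-T) < g (-T) := by
  rcases lt_trichotomy (f (-T)) (g (-T)) with h3 | h3 | h3
  · exact h3
  · exact absurd h3 h.ne_nT
  · exact absurd (h.le h3 hS z) (not_le.2 hz)

/-- `a - b` is increasing through zero in the `y` direction. -/
def Up (a b : PP) : Prop := ∀ x y y' : ℝ, y < y' → b x y ≤ a x y → b x y' < a x y'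

def OrP (a b : PP) : Prop := Up a b ∨ Up b a

theorem OrP.symm {a b : PP} (h : OrP a b) : OrP b a := Or.symm h

def ngP (a : PP) : PP := fun x y => - a x y

theorem Up.neg {a b : PP} (h : Up a b) : Up (ngP b) (ngP a) := by
  intro x y y' hy hle
  have := h x y y' hy (by simpa [ngP] using hle)
  simpa [ngP] using this

theorem OrP.neg {a b : PP} (h : OrP a b) : OrP (ngP a) (ngP b) := by
  rcases h with h | h
  · exact Or.inr h.neg
  · exact Or.inl h.neg

theorem same_side {f : ℝ × ℝ → ℝ} (hf : Continuous f) {φ : ℝ → ℝ} (hφ : Continuous φ)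
    (h : ∀ x y, f (x, y) = 0 ↔ y = φ x) {x1 h1 x2 h2 : ℝ} (hh : 0 < h1 * h2)
    (hp : 0 < f (x1, φ x1 + h1)) : 0 < f (x2, φ x2 + h2) := by
  by_contra hc
  have hne : ∀ x k : ℝ, k ≠ 0 → f (x, φ x + k) ≠ 0 := by
    intro x k hk h0
    have := (h _ _).1 h0
    apply hk; linarith
  have h1n : h1 ≠ 0 := by rintro rfl; simp at hh
  have h2n : h2 ≠ 0 := by rintro rfl; simp at hh
  have hlt := lt_of_le_of_ne (not_lt.1 hc) (hne x2 h2 h2n)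
  let X : ℝ → ℝ := fun s => (1 - s) * x1 + s * x2
  let H : ℝ → ℝ := fun s => (1 - s) * h1 + s * h2
  have hX : Continuous X := by fun_prop
  have hH : Continuous H := by fun_prop
  let g : ℝ → ℝ := fun s => f (X s, φ (X s) + H s)
  have hg : Continuous g := hf.comp (hX.prodMk ((hφ.comp hX).add hH))
  have g0 : 0 < g 0 := by simpa [g, X, H] using hp
  have g1 : g 1 < 0 := by simpa [g, X, H] using hlt
  obtain ⟨z, hz, hz'⟩ := ivt_two (f := g) (g := fun _ => 0) hg continuous_const (x := 1) (y := 0) g1 g0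
  rcases hz' with ⟨h3, h4⟩ | ⟨h3, h4⟩
  · linarith
  · refine hne (X z) (H z) ?_ hz
    rcases mul_pos_iff.1 hh with ⟨p1, p2⟩ | ⟨p1, p2⟩
    · have : 0 < H z := by
        have := mul_pos (sub_pos.2 h4) p1
        have := mul_pos h3 p2
        simp only [H]; linarith
      exact this.ne'
    · have : H z < 0 := by
        have := mul_neg_of_pos_of_neg (sub_pos.2 h4) p1
        have := mul_neg_of_pos_of_neg h3 p2
        simp only [H]; linarith
      exact this.ne

theorem up_of_signs {a b : PP} {φ : ℝ → ℝ} (hφ : ∀ x y, a x y = b x y ↔ y = φ x)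
    (hp : ∀ x h, 0 < h → b x (φ x + h) < a x (φ x + h))
    (hm : ∀ x h, h < 0 → a x (φ x + h) < b x (φ x + h)) : Up a b := by
  intro x y y' hy hle
  have h1 : φ x ≤ y := by
    by_contra hc
    have := hm x (y - φ x) (by linarith)
    rw [add_sub_cancel] at this
    linarith
  have := hp x (y' - φ x) (by linarith)
  rwa [add_sub_cancel] at this

theorem orP_of {a b : PP} (ha : Continuous fun q : ℝ × ℝ => a q.1 q.2)
    (hb : Continuous fun q : ℝ × ℝ => b q.1 q.2) {φ : ℝ → ℝ} (hφ : IsGraphFun a b φ)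
    (h6 : (∃ x y : ℝ, a x y < b x y) ∧ (∃ x y : ℝ, b x y < a x y)) : OrP a b := by
  have hz : ∀ x y, (fun q : ℝ × ℝ => a q.1 q.2 - b q.1 q.2) (x, y) = 0 ↔ y = φ x := by
    intro x y; simp only [sub_eq_zero]; exact hφ.2 x y
  have hz' : ∀ x y, (fun q : ℝ × ℝ => b q.1 q.2 - a q.1 q.2) (x, y) = 0 ↔ y = φ x := by
    intro x y; simp only [sub_eq_zero]; rw [eq_comm]; exact hφ.2 x y
  have S : ∀ x1 h1 x2 h2 : ℝ, 0 < h1 * h2 → b x1 (φ x1 + h1) < a x1 (φ x1 + h1) →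
      b x2 (φ x2 + h2) < a x2 (φ x2 + h2) := by
    intro x1 h1 x2 h2 hh hp
    have := same_side (ha.sub hb) hφ.1 hz (x1 := x1) (h1 := h1) (x2 := x2) (h2 := h2) hh
      (by simpa using hp)
    simpa using this
  have S' : ∀ x1 h1 x2 h2 : ℝ, 0 < h1 * h2 → a x1 (φ x1 + h1) < b x1 (φ x1 + h1) →
      a x2 (φ x2 + h2) < b x2 (φ x2 + h2) := by
    intro x1 h1 x2 h2 hh hp
    have := same_side (hb.sub ha) hφ.1 hz' (x1 := x1) (h1 := h1) (x2 := x2) (h2 := h2) hh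
      (by simpa using hp)
    simpa using this
  obtain ⟨⟨x1, y1, h1⟩, ⟨x2, y2, h2⟩⟩ := h6
  have e1 : a x1 (φ x1 + (y1 - φ x1)) < b x1 (φ x1 + (y1 - φ x1)) := by
    rwa [add_sub_cancel]
  have e2 : b x2 (φ x2 + (y2 - φ x2)) < a x2 (φ x2 + (y2 - φ x2)) := by
    rwa [add_sub_cancel]
  have n1 : y1 ≠ φ x1 := fun h => by have := (hφ.2 x1 y1).2 h; linarith
  have n2 : y2 ≠ φ x2 := fun h => by have := (hφ.2 x2 y2).2 h; linarith
  have nn : ¬ 0 < (y1 - φ x1) * (y2 - φ x2) := fun h => by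
    have := S' _ _ x2 (y2 - φ x2) h e1
    linarith
  rcases lt_or_gt_of_ne n1 with g1 | g1 <;> rcases lt_or_gt_of_ne n2 with g2 | g2
  · exact absurd (mul_pos_of_neg_of_neg (sub_neg.2 g1) (sub_neg.2 g2)) nn
  · left
    refine up_of_signs hφ.2 (fun x h hh => S _ _ x h (mul_pos (sub_pos.2 g2) hh) e2)
      (fun x h hh => S' _ _ x h (mul_pos_of_neg_of_neg (sub_neg.2 g1) hh) e1)
  · right
    refine up_of_signs (fun x y => by rw [eq_comm]; exact hφ.2 x y)
      (fun x h hh => S' _ _ x h (mul_pos (sub_pos.2 g1) hh) e1)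
      (fun x h hh => S _ _ x h (mul_pos_of_neg_of_neg (sub_neg.2 g2) hh) e2)
  · exact absurd (mul_pos (sub_pos.2 g1) (sub_pos.2 g2)) nn

/-- Strictly opposite order of `e` and `f` at the two points. -/
def Opp (e f : PP) (x y x' y' : ℝ) : Prop :=
  (e x y < f x y ∧ f x' y' < e x' y') ∨ (f x y < e x y ∧ e x' y' < f x' y')

theorem geo {p q e f : PP} {T S uT uS yT yS : ℝ} (hpq : OrP p q) (h1 : q T uT < p T uT)
    (h2 : q S uS < p S uS) (h3 : p T yT = q T yT) (h4 : p S yS = q S yS) (hef : OrP e f)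
    (h5 : e T uT < f T uT) (h6 : f S uS < e S uS) (ho : Opp e f T yT S yS) :
    e T yT < f T yT := by
  rcases ho with ho | ho
  · exact ho.1
  exfalso
  obtain ⟨o1, o2⟩ := ho
  rcases hpq with hp | hp
  · have l1 : yT < uT := by
      rcases lt_trichotomy yT uT with h | h | h
      · exact h
      · rw [h] at h3; linarith
      · have := hp T uT yT h h1.le; linarith
    have l2 : yS < uS := by
      rcases lt_trichotomy yS uS with h | h | h
      · exact h
      · rw [h] at h4; linarith
      · have := hp S uS yS h h2.le; linarith
    rcases hef with he | he
    · have := he T yT uT l1 o1.le; linarith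
    · have := he S yS uS l2 o2.le; linarith
  · have l1 : uT < yT := by
      rcases lt_trichotomy uT yT with h | h | h
      · exact h
      · rw [← h] at h3; linarith
      · have := hp T yT uT h h3.le; linarith
    have l2 : uS < yS := by
      rcases lt_trichotomy uS yS with h | h | h
      · exact h
      · rw [← h] at h4; linarith
      · have := hp S yS uS h h4.le; linarith
    rcases hef with he | he
    · have := he S uS yS l2 h6.le; linarith
    · have := he T uT yT l1 h5.le; linarith

/-- `p` above `q` at `u`, equal at `y`. -/
theorem Up.lt_of {p q : PP} (h : Up p q) {x u y : ℝ} (h1 : q x u < p x u) (h2 : p x y = q x y) :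
    y < u := by
  rcases lt_trichotomy y u with h' | h' | h'
  · exact h'
  · rw [h'] at h2; linarith
  · have := h x u y h' h1.le; linarith

theorem Up.gt_of {p q : PP} (h : Up q p) {x u y : ℝ} (h1 : q x u < p x u) (h2 : p x y = q x y) :
    u < y := by
  rcases lt_trichotomy u y with h' | h' | h'
  · exact h'
  · rw [← h'] at h2; linarith
  · have := h x y u h' h2.le; linarith

/-- Case II: the signs at `T` are opposite. -/
theorem geo2 {a a' b : PP} {T S uT uS yT yS zT zS : ℝ} (hab : OrP a b) (hab' : OrP a' b)
    (h1 : b T uT < a T uT) (h2 : b S uS < a S uS) (h1' : b T uT < a' T uT) (h2' : b S uS < a' S uS)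
    (h3 : a T yT = b T yT) (h4 : a S yS = b S yS)
    (h3' : a' T zT = b T zT) (h4' : a' S zS = b S zS)
    (ho : Opp a' a T yT S yS) (ho' : Opp a a' T zT S zS) :
    (a' T yT < a T yT ∧ a' T zT < a T zT) ∨ (a T yT < a' T yT ∧ a T zT < a' T zT) := by
  have hne : yT ≠ zT := by
    rintro rfl
    rcases ho with ho | ho <;> linarith
  rcases hab with k | k <;> rcases hab' with k' | k'
  · rcases lt_or_gt_of_ne hne with h | h
    · left
      have e1 := k T yT zT h h3.ge
      refine ⟨?_, by linarith⟩
      by_contra hc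
      have := k' T yT zT h (by linarith)
      linarith
    · right
      have e1 := k' T zT yT h h3'.ge
      refine ⟨by linarith, ?_⟩
      by_contra hc
      have := k T zT yT h (by linarith)
      linarith
  · exfalso
    have l1 := k.lt_of h1 h3
    have l2 := k.lt_of h2 h4
    have m1 : b T yT < a' T yT := by
      by_contra hc
      have := k' T yT uT l1 (not_lt.1 hc); linarith
    have m2 : b S yS < a' S yS := by
      by_contra hc
      have := k' S yS uS l2 (not_lt.1 hc); linarith
    rcases ho with ho | ho <;> linarith
  · exfalso
    have l1 := k'.lt_of h1' h3'
    have l2 := k'.lt_of h2' h4'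
    have m1 : b T zT < a T zT := by
      by_contra hc
      have := k T zT uT l1 (not_lt.1 hc); linarith
    have m2 : b S zS < a S zS := by
      by_contra hc
      have := k S zS uS l2 (not_lt.1 hc); linarith
    rcases ho' with ho | ho <;> linarith
  · rcases lt_or_gt_of_ne hne with h | h
    · right
      have m : b T yT < a' T yT := by
        by_contra hc
        have := k' T yT zT h (not_lt.1 hc); linarith
      have e1 := k T yT zT h h3.le
      exact ⟨by linarith, by linarith⟩
    · left
      have m : b T zT < a T zT := by
        by_contra hc
        have := k T zT yT h (not_lt.1 hc); linarith
      have e1 := k' T zT yT h h3'.le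
      exact ⟨by linarith, by linarith⟩

/-- Sign rules for a pair `A` (above `v` at `-T`) and `B` (below `v` at `-T`). -/
def Rule (T : ℝ) (A B v : ℝ → ℝ) (xa xb : ℝ) (s : ℤ) : Prop :=
  (s = 1 ∨ s = -1) ∧
  (v T < A T → v T < B T → s = 1) ∧
  (A T < v T → B T < v T → s = -1) ∧
  (A T < v T → v T < B T → (xb < xa → s = 1) ∧ (xa < xb → s = -1)) ∧
  (v T < A T → B T < v T → (xa < xb → s = 1) ∧ (xb < xa → s = -1))

section oneD
variable {T : ℝ} {A A' B v : ℝ → ℝ} {xa xa' xb : ℝ} {s s' : ℤ}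

theorem k1 (hAv : Once T A v) (hBv : Once T B v) (hA : v (-T) < A (-T)) (hB : B (-T) < v (-T))
    (xaz : A xa = v xa) (xbz : B xb = v xb) (r : Rule T A B v xa xb s) {t : ℝ}
    (ht : A t = B t) (hv : v t < A t) : s = 1 := by
  have hb : v T < B T := hBv.symm.pass hB (ht ▸ hv)
  have hxb : xb < t := by
    by_contra hc
    rcases lt_or_eq_of_le (not_lt.1 hc) with h | h
    · have := hBv.symm.s1 xbz.symm hB h; linarith
    · rw [← h] at xbz; linarith
  rcases lt_or_gt_of_ne hAv.ne_T with h | h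
  · refine (r.2.2.2.1 h hb).1 ?_
    by_contra hc
    have h1 : xa < t := lt_of_le_of_lt (not_lt.1 hc) hxb
    have := hAv.symm.s2 xaz.symm h h1
    linarith
  · exact r.2.1 h hb

theorem k2 (hAv : Once T A v) (hBv : Once T B v) (hA : v (-T) < A (-T)) (hB : B (-T) < v (-T))
    (xaz : A xa = v xa) (xbz : B xb = v xb) (r : Rule T A B v xa xb s) {t : ℝ}
    (ht : A t = B t) (hv : A t < v t) : s = -1 := by
  have ha : A T < v T := hAv.pass hA hv
  have hxa : xa < t := by
    by_contra hc
    rcases lt_or_eq_of_le (not_lt.1 hc) with h | h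
    · have := hAv.s1 xaz hA h; linarith
    · rw [← h] at xaz; linarith
  rcases lt_or_gt_of_ne hBv.ne_T with h | h
  · exact r.2.2.1 ha h
  · refine (r.2.2.2.1 ha h).2 ?_
    by_contra hc
    have h1 : xb < t := lt_of_le_of_lt (not_lt.1 hc) hxa
    have := hBv.s2 xbz h h1
    linarith

def Cntd (A A' B v : ℝ → ℝ) : Prop :=
  ∀ x, (A x < v x ∨ A' x < v x ∨ B x < v x) ∧ (v x < A x ∨ v x < A' x ∨ v x < B x)

theorem Cntd.swap (h : Cntd A A' B v) : Cntd A' A B v := fun x => by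
  have := h x; tauto

theorem caseI (hAv : Once T A v) (hAv' : Once T A' v) (hBv : Once T B v)
    (hA : v (-T) < A (-T)) (hA' : v (-T) < A' (-T)) (hB : B (-T) < v (-T))
    (xaz : A xa = v xa) (xaz' : A' xa' = v xa') (xbz : B xb = v xb)
    (r : Rule T A B v xa xb s) (r' : Rule T A' B v xa' xb s') {t t' : ℝ}
    (ht : A t = B t) (ht' : A' t' = B t') (htt : t < t')
    (hAB : A T < B T) (g1 : B t < A' t) (g2 : A t' < B t') :
    (s = -1 ∨ s' = 1) ∧ (Cntd A A' B v → s = -1 ∧ s' = 1) := by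
  constructor
  · by_contra hc
    obtain ⟨c1, c2⟩ := not_or.1 hc
    have e1 : s = 1 := by rcases r.1 with h | h; exacts [h, absurd h c1]
    have hv : v t ≤ A t := by
      by_contra h
      exact c1 (k2 hAv hBv hA hB xaz xbz r ht (not_le.1 h))
    have hv' : A' t' ≤ v t' := by
      by_contra h
      exact c2 (k1 hAv' hBv hA' hB xaz' xbz r' ht' (not_le.1 h))
    rcases lt_or_gt_of_ne hBv.ne_T with h | h
    · exact c1 (r.2.2.1 (hAB.trans h) h)
    · have hx : xb ≤ t := by
        by_contra hc
        have := hBv.symm.s1 xbz.symm hB (not_le.1 hc)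
        linarith
      have := hBv.s2 xbz h (lt_of_le_of_lt hx htt)
      linarith
  · intro hc
    constructor
    · refine k2 hAv hBv hA hB xaz xbz r ht ?_
      have := (hc t).1
      rcases this with h | h | h <;> linarith
    · refine k1 hAv' hBv hA' hB xaz' xbz r' ht' ?_
      have := (hc t').2
      rcases this with h | h | h <;> linarith

theorem caseIII (hAv : Once T A v) (hAv' : Once T A' v) (hBv : Once T B v)
    (hA : v (-T) < A (-T)) (hA' : v (-T) < A' (-T)) (hB : B (-T) < v (-T))
    (xaz : A xa = v xa) (xaz' : A' xa' = v xa') (xbz : B xb = v xb)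
    (r : Rule T A B v xa xb s) (r' : Rule T A' B v xa' xb s') {t : ℝ}
    (ht : A t = B t) (hAB : A T < B T) (hAB' : B T < A' T) (hle : ∀ x, B x ≤ A' x) :
    (s = -1 ∨ s' = 1) ∧ (Cntd A A' B v → s = -1 ∧ s' = 1) := by
  rcases lt_or_gt_of_ne hBv.ne_T with h | h
  · have e1 := r.2.2.1 (hAB.trans h) h
    refine ⟨Or.inl e1, fun hc => ⟨e1, ?_⟩⟩
    have hT : v T < A' T := by
      rcases (hc T).2 with h1 | h1 | h1
      · linarith
      · exact h1
      · linarith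
    refine (r'.2.2.2.2 hT h).1 ?_
    have c1 : A xb < v xb := by
      have := hle xb
      rcases (hc xb).1 with h1 | h1 | h1 <;> linarith
    have c2 : v xa' < A xa' := by
      have := hle xa'
      rcases (hc xa').2 with h1 | h1 | h1 <;> linarith
    have d1 : xa ≤ xb := by
      by_contra hh
      have := hAv.s1 xaz hA (not_le.1 hh); linarith
    have d2 : xa' < xa := by
      by_contra hh
      rcases lt_or_eq_of_le (not_lt.1 hh) with h1 | h1
      · have := hAv.symm.s2 xaz.symm (hAB.trans h) h1; linarith
      · rw [← h1] at c2; linarith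
    linarith
  · have e1 := r'.2.1 (h.trans hAB') h
    refine ⟨Or.inr e1, fun hc => ⟨?_, e1⟩⟩
    refine k2 hAv hBv hA hB xaz xbz r ht ?_
    have := hle t
    by_contra hh
    rcases (hc t).1 with h1 | h1 | h1 <;> linarith

theorem caseII (hAv : Once T A v) (hAv' : Once T A' v) (hBv : Once T B v) (hAA : Once T A A')
    (hA : v (-T) < A (-T)) (hA' : v (-T) < A' (-T))
    (xaz : A xa = v xa) (xaz' : A' xa' = v xa') (xbz : B xb = v xb)
    (r : Rule T A B v xa xb s) (r' : Rule T A' B v xa' xb s')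
    (hle' : ∀ x, B x ≤ A' x) (hBT : B T < v T)
    (tie1 : v T < A T → B T < v T → A' T < v T → xa = xb → xa' = xb → s = -1)
    (tie2 : v T < A T → v T < A' T → B T < v T → xa = xb → xa' = xb → s = s')
    (hs : s = 1) (hs' : s' = -1) : A (-T) < A' (-T) ∧ A' T < A T := by
  have hAT : v T < A T := by
    rcases lt_or_gt_of_ne hAv.ne_T with h | h
    · have := r.2.2.1 h hBT; omega
    · exact h
  have x1 : xa ≤ xb := by
    by_contra h
    have := (r.2.2.2.2 hAT hBT).2 (not_le.1 h); omega
  have x2 : xb ≤ xa' ∧ xa ≠ xa' := by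
    rcases lt_or_gt_of_ne hAv'.ne_T with h | h
    · have : xb ≤ xa' := by
        by_contra hc
        have := hAv'.symm.s2 xaz'.symm h (not_le.1 hc)
        have := hle' xb
        linarith
      refine ⟨this, fun he => ?_⟩
      have := tie1 hAT hBT h (by linarith) (by linarith)
      omega
    · have : xb ≤ xa' := by
        by_contra hc
        have := (r'.2.2.2.2 h hBT).1 (not_le.1 hc)
        omega
      refine ⟨this, fun he => ?_⟩
      have := tie2 hAT h hBT (by linarith) (by linarith)
      omega
  have x3 : xa < xa' := lt_of_le_of_ne (x1.trans x2.1) x2.2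
  have e1 : A xa < A' xa := by
    have := hAv'.s1 xaz' hA' x3; linarith
  have e2 : A' xa' < A xa' := by
    have := hAv.s2 xaz hAT x3; linarith
  obtain ⟨z, hz, hz'⟩ := ivt_two hAA.1 hAA.2.1 e1 e2
  have hzz : xa < z ∧ z < xa' := by
    rcases hz' with h | h
    · exact h
    · linarith [h.1, h.2]
  constructor
  · rcases lt_or_gt_of_ne hAA.ne_nT with h | h
    · exact h
    · have := hAA.s1 hz h hzz.1; linarith
  · rcases lt_or_gt_of_ne hAA.ne_T with h | h
    · have := hAA.symm.s2 hz.symm h hzz.2; linarith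
    · exact h

theorem tri1d (hTp : 0 < T) (hAv : Once T A v) (hAv' : Once T A' v) (hBv : Once T B v)
    (hAA : Once T A A') (hAB : Once T A B) (hAB' : Once T A' B)
    (hA : v (-T) < A (-T)) (hA' : v (-T) < A' (-T)) (hB : B (-T) < v (-T))
    (xaz : A xa = v xa) (xaz' : A' xa' = v xa') (xbz : B xb = v xb)
    (r : Rule T A B v xa xb s) (r' : Rule T A' B v xa' xb s')
    (tie1 : v T < A T → B T < v T → A' T < v T → xa = xb → xa' = xb → s = -1)
    (tie1' : v T < A' T → B T < v T → A T < v T → xa' = xb → xa = xb → s' = -1)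
    (tie2 : v T < A T → v T < A' T → B T < v T → xa = xb → xa' = xb → s = s')
    {W W' : ℤ}
    (hc : A T < B T → ∀ t, A t = B t →
      (A' t < A t → W = s) ∧ (A t < A' t → W = -s) ∧ (A' t = A t → W = 1))
    (hc' : A' T < B T → ∀ t, A' t = B t →
      (A t < A' t → W' = s') ∧ (A' t < A t → W' = -s') ∧ (A t = A' t → W' = 1))
    (h3 : A T < B T → B T < A' T → W' = s')
    (h3' : A' T < B T → B T < A T → W = s)
    (h2 : B T < A T → B T < A' T → (W = s ∧ W' = -s') ∨ (W = -s ∧ W' = s'))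
    (h2a : B T < A T → B T < A' T → A (-T) < A' (-T) → A' T < A T → W = s)
    (h2b : B T < A T → B T < A' T → A' (-T) < A (-T) → A T < A' T → W' = s') :
    0 ≤ W + W' ∧ (Cntd A A' B v → 2 ≤ W + W') := by
  have hABS : B (-T) < A (-T) := hB.trans hA
  have hABS' : B (-T) < A' (-T) := hB.trans hA'
  have rs := r.1
  have rs' := r'.1
  rcases lt_or_gt_of_ne hAB.ne_T with c | c <;> rcases lt_or_gt_of_ne hAB'.ne_T with c' | c'
  · obtain ⟨t, ht, hb, ha⟩ := hAB.meet hTp hABS c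
    obtain ⟨t', ht', hb', ha'⟩ := hAB'.meet hTp hABS' c'
    have w := hc c t ht
    have w' := hc' c' t' ht'
    rcases lt_trichotomy t t' with h | h | h
    · have g1 := hb' t h
      have g2 := ha t' h
      have := caseI hAv hAv' hBv hA hA' hB xaz xaz' xbz r r' ht ht' h c g1 g2
      rw [w.2.1 (by linarith), w'.1 (by linarith)]
      refine ⟨by omega, fun hC => ?_⟩
      have := this.2 hC
      omega
    · subst h
      rw [w.2.2 (by linarith), w'.2.2 (by linarith)]
      refine ⟨by omega, fun hC => by omega⟩
    · have g1 := hb t' h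
      have g2 := ha' t h
      have := caseI hAv' hAv hBv hA' hA hB xaz' xaz xbz r' r ht' ht h c' g1 g2
      rw [w.1 (by linarith), w'.2.1 (by linarith)]
      refine ⟨by omega, fun hC => ?_⟩
      have := this.2 hC.swap
      omega
  · obtain ⟨t, ht, hb, ha⟩ := hAB.meet hTp hABS c
    have w := hc c t ht
    have hle := hAB'.le hABS' c'
    have := caseIII hAv hAv' hBv hA hA' hB xaz xaz' xbz r r' ht c c' hle
    rw [h3 c c']
    rcases lt_or_eq_of_le (hle t) with h | h
    · rw [w.2.1 (by linarith)]
      refine ⟨by omega, fun hC => ?_⟩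
      have := this.2 hC
      omega
    · rw [w.2.2 (by linarith)]
      refine ⟨by omega, fun hC => ?_⟩
      have := this.2 hC
      omega
  · obtain ⟨t, ht, hb, ha⟩ := hAB'.meet hTp hABS' c'
    have w := hc' c' t ht
    have hle := hAB.le hABS c
    have := caseIII hAv' hAv hBv hA' hA hB xaz' xaz xbz r' r ht c' c hle
    rw [h3' c' c]
    rcases lt_or_eq_of_le (hle t) with h | h
    · rw [w.2.1 (by linarith)]
      refine ⟨by omega, fun hC => ?_⟩
      have := this.2 hC.swap
      omega
    · rw [w.2.2 (by linarith)]
      refine ⟨by omega, fun hC => ?_⟩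
      have := this.2 hC.swap
      omega
  · have hle := hAB.le hABS c
    have hle' := hAB'.le hABS' c'
    constructor
    · rcases lt_or_gt_of_ne hBv.ne_T with h | h
      · have t1 := caseII hAv hAv' hBv hAA hA hA' xaz xaz' xbz r r' hle' h tie1 tie2
        have t2 := caseII hAv' hAv hBv hAA.symm hA' hA xaz' xaz xbz r' r hle h tie1'
          (fun a b c d e => (tie2 b a c e d).symm)
        have h22 := h2 c c'
        rcases rs with e | e <;> rcases rs' with e' | e'
        · omega
        · have := t1 e e'
          have := h2a c c' this.1 this.2
          omega
        · have := t2 e' e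
          have := h2b c c' this.1 this.2
          omega
        · omega
      · have e1 := r.2.1 (h.trans c) h
        have e2 := r'.2.1 (h.trans c') h
        have := h2 c c'
        omega
    · intro hC
      exfalso
      have k1 := hle xb
      have k2 := hle' xb
      rcases (hC xb).1 with h | h | h <;> linarith

end oneD

/-- The weight. -/
def wt (s : ℤ) (c a : ℝ) : ℤ := if c < a then s else if a < c then -s else 1

theorem wt_lt {s : ℤ} {c a : ℝ} (h : c < a) : wt s c a = s := by simp [wt, h]
theorem wt_gt {s : ℤ} {c a : ℝ} (h : a < c) : wt s c a = -s := by simp [wt, h, not_lt.2 h.le]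
theorem wt_eq {s : ℤ} {c a : ℝ} (h : c = a) : wt s c a = 1 := by simp [wt, h]
theorem wt_neg (s : ℤ) (c a : ℝ) : wt (-s) (-c) (-a) = wt s c a := by
  rcases lt_trichotomy c a with h | h | h
  · rw [wt_lt h, wt_gt (by linarith)]; simp
  · rw [wt_eq h, wt_eq (by linarith)]
  · rw [wt_gt h, wt_lt (by linarith)]

/-- restriction of a pseudoplane to the curve `u` -/
def rs (u : ℝ → ℝ) (a : PP) : ℝ → ℝ := fun x => a x (u x)

theorem tri_xxy {T : ℝ} {u v : ℝ → ℝ} {a a' b : PP} {xa xa' xb : ℝ} {s s' : ℤ}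
    {φ φ' : ℝ → ℝ} {t t' : ℝ}
    (hTp : 0 < T) (hAv : Once T (rs u a) v) (hAv' : Once T (rs u a') v) (hBv : Once T (rs u b) v)
    (hAA : Once T (rs u a) (rs u a')) (hAB : Once T (rs u a) (rs u b))
    (hAB' : Once T (rs u a') (rs u b))
    (hA : v (-T) < rs u a (-T)) (hA' : v (-T) < rs u a' (-T)) (hB : rs u b (-T) < v (-T))
    (xaz : rs u a xa = v xa) (xaz' : rs u a' xa' = v xa') (xbz : rs u b xb = v xb)
    (r : Rule T (rs u a) (rs u b) v xa xb s) (r' : Rule T (rs u a') (rs u b) v xa' xb s')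
    (tie1 : v T < rs u a T → rs u b T < v T → rs u a' T < v T → xa = xb → xa' = xb → s = -1)
    (tie1' : v T < rs u a' T → rs u b T < v T → rs u a T < v T → xa' = xb → xa = xb → s' = -1)
    (tie2 : v T < rs u a T → v T < rs u a' T → rs u b T < v T → xa = xb → xa' = xb → s = s')
    (hφ : ∀ x y, a x y = b x y ↔ y = φ x) (hφ' : ∀ x y, a' x y = b x y ↔ y = φ' x)
    (oab : OrP a b) (oab' : OrP a' b) (oaa : OrP a a')
    (op : Opp a' a T (φ T) (-T) (φ (-T))) (op' : Opp a a' T (φ' T) (-T) (φ' (-T)))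
    (ht : rs u a T < rs u b T → u t = φ t) (htT : rs u b T < rs u a T → t = T)
    (ht' : rs u a' T < rs u b T → u t' = φ' t') (htT' : rs u b T < rs u a' T → t' = T) :
    0 ≤ wt s (a' t (φ t)) (a t (φ t)) + wt s' (a t' (φ' t')) (a' t' (φ' t')) ∧
      (Cntd (rs u a) (rs u a') (rs u b) v →
        2 ≤ wt s (a' t (φ t)) (a t (φ t)) + wt s' (a t' (φ' t')) (a' t' (φ' t'))) := by
  have hABS : b (-T) (u (-T)) < a (-T) (u (-T)) := hB.trans hA
  have hABS' : b (-T) (u (-T)) < a' (-T) (u (-T)) := hB.trans hA'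
  have e : ∀ x, a x (φ x) = b x (φ x) := fun x => (hφ x _).2 rfl
  have e' : ∀ x, a' x (φ' x) = b x (φ' x) := fun x => (hφ' x _).2 rfl
  refine tri1d hTp hAv hAv' hBv hAA hAB hAB' hA hA' hB xaz xaz' xbz r r' tie1 tie1' tie2
    ?_ ?_ ?_ ?_ ?_ ?_ ?_
  · intro c τ hτ
    have h1 := ht c
    have h2 : rs u a t = rs u b t := by simp only [rs]; rw [h1]; exact e t
    have h3 := hAB.2.2.1 τ t hτ h2
    subst h3
    simp only [rs]; rw [h1]
    exact ⟨wt_lt, wt_gt, wt_eq⟩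
  · intro c τ hτ
    have h1 := ht' c
    have h2 : rs u a' t' = rs u b t' := by simp only [rs]; rw [h1]; exact e' t'
    have h3 := hAB'.2.2.1 τ t' hτ h2
    subst h3
    simp only [rs]; rw [h1]
    exact ⟨wt_lt, wt_gt, wt_eq⟩
  · intro c c'
    rw [htT' c']
    apply wt_lt
    have := geo (p := a') (q := b) (e := a) (f := b) oab' c' hABS' (e' T) (e' (-T)) oab c hABS
      (by simp only [Opp, ← e']; exact op')
    rw [e']; exact this
  · intro c' c
    rw [htT c]
    apply wt_lt
    have := geo (p := a) (q := b) (e := a') (f := b) oab c hABS (e T) (e (-T)) oab' c' hABS'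
      (by simp only [Opp, ← e]; exact op)
    rw [e]; exact this
  · intro c c'
    rw [htT c, htT' c']
    rcases geo2 oab oab' c hABS c' hABS' (e T) (e (-T)) (e' T) (e' (-T)) op op' with h | h
    · exact Or.inl ⟨wt_lt h.1, wt_gt h.2⟩
    · exact Or.inr ⟨wt_gt h.1, wt_lt h.2⟩
  · intro c c' g1 g2
    rw [htT c]
    exact wt_lt (geo oab c hABS (e T) (e (-T)) oaa.symm g2 g1 op)
  · intro c c' g1 g2
    rw [htT' c']
    exact wt_lt (geo oab' c' hABS' (e' T) (e' (-T)) oaa g2 g1 op')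

theorem Rule.neg {T : ℝ} {A B v : ℝ → ℝ} {xa xb : ℝ} {s : ℤ} (r : Rule T A B v xa xb s) :
    Rule T (fun x => - B x) (fun x => - A x) (fun x => - v x) xb xa (-s) := by
  obtain ⟨r0, r1, r2, r3, r4⟩ := r
  refine ⟨by omega, ?_, ?_, ?_, ?_⟩ <;> simp only [neg_lt_neg_iff]
  · intro h1 h2; rw [r2 h2 h1]; rfl
  · intro h1 h2; rw [r1 h2 h1]
  · intro h1 h2
    have := r3 h2 h1
    exact ⟨fun h => by rw [this.2 h]; rfl, fun h => by rw [this.1 h]⟩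
  · intro h1 h2
    have := r4 h2 h1
    exact ⟨fun h => by rw [this.2 h]; rfl, fun h => by rw [this.1 h]⟩

theorem Opp.neg {e f : PP} {x y x' y' : ℝ} (h : Opp e f x y x' y') :
    Opp (ngP e) (ngP f) x y x' y' := by
  simp only [Opp, ngP, neg_lt_neg_iff]
  rcases h with h | h
  · exact Or.inr ⟨h.1, h.2⟩
  · exact Or.inl ⟨h.1, h.2⟩

/-- The mirrored case: `a` above, `b`, `b'` below at `-T`. -/
theorem tri_xyy {T : ℝ} {u v : ℝ → ℝ} {a b b' : PP} {xa xb xb' : ℝ} {s s' : ℤ}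
    {φ φ' : ℝ → ℝ} {t t' : ℝ}
    (hTp : 0 < T) (hAv : Once T (rs u a) v) (hBv : Once T (rs u b) v) (hBv' : Once T (rs u b') v)
    (hBB : Once T (rs u b) (rs u b')) (hAB : Once T (rs u a) (rs u b))
    (hAB' : Once T (rs u a) (rs u b'))
    (hA : v (-T) < rs u a (-T)) (hB : rs u b (-T) < v (-T)) (hB' : rs u b' (-T) < v (-T))
    (xaz : rs u a xa = v xa) (xbz : rs u b xb = v xb) (xbz' : rs u b' xb' = v xb')
    (r : Rule T (rs u a) (rs u b) v xa xb s) (r' : Rule T (rs u a) (rs u b') v xa xb' s')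
    (tie1 : rs u b T < v T → v T < rs u a T → v T < rs u b' T → xb = xa → xb' = xa → s = 1)
    (tie1' : rs u b' T < v T → v T < rs u a T → v T < rs u b T → xb' = xa → xb = xa → s' = 1)
    (tie2 : rs u b T < v T → rs u b' T < v T → v T < rs u a T → xb = xa → xb' = xa → s = s')
    (hφ : ∀ x y, a x y = b x y ↔ y = φ x) (hφ' : ∀ x y, a x y = b' x y ↔ y = φ' x)
    (oab : OrP a b) (oab' : OrP a b') (obb : OrP b b')
    (op : Opp b' b T (φ T) (-T) (φ (-T))) (op' : Opp b b' T (φ' T) (-T) (φ' (-T)))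
    (ht : rs u a T < rs u b T → u t = φ t) (htT : rs u b T < rs u a T → t = T)
    (ht' : rs u a T < rs u b' T → u t' = φ' t') (htT' : rs u b' T < rs u a T → t' = T) :
    0 ≤ wt s (b' t (φ t)) (a t (φ t)) + wt s' (b t' (φ' t')) (a t' (φ' t')) ∧
      (Cntd (rs u b) (rs u b') (rs u a) v →
        2 ≤ wt s (b' t (φ t)) (a t (φ t)) + wt s' (b t' (φ' t')) (a t' (φ' t'))) := by
  have e : ∀ x, a x (φ x) = b x (φ x) := fun x => (hφ x _).2 rfl
  have e' : ∀ x, a x (φ' x) = b' x (φ' x) := fun x => (hφ' x _).2 rfl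
  have := tri_xxy (T := T) (u := u) (v := fun x => - v x) (a := ngP b) (a' := ngP b') (b := ngP a)
    (xa := xb) (xa' := xb') (xb := xa) (s := -s) (s' := -s') (φ := φ) (φ' := φ') (t := t) (t' := t')
    hTp hBv.neg hBv'.neg hAv.neg hBB.neg hAB.symm.neg hAB'.symm.neg
    (neg_lt_neg hB) (neg_lt_neg hB') (neg_lt_neg hA) (congrArg Neg.neg xbz) (congrArg Neg.neg xbz')
    (congrArg Neg.neg xaz) r.neg r'.neg
    (fun h1 h2 h3 h4 h5 => by
      rw [tie1 (neg_lt_neg_iff.1 h1) (neg_lt_neg_iff.1 h2) (neg_lt_neg_iff.1 h3) h4 h5])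
    (fun h1 h2 h3 h4 h5 => by
      rw [tie1' (neg_lt_neg_iff.1 h1) (neg_lt_neg_iff.1 h2) (neg_lt_neg_iff.1 h3) h4 h5])
    (fun h1 h2 h3 h4 h5 => by
      rw [tie2 (neg_lt_neg_iff.1 h1) (neg_lt_neg_iff.1 h2) (neg_lt_neg_iff.1 h3) h4 h5])
    (fun x y => by simp only [ngP, neg_inj]; rw [eq_comm]; exact hφ x y)
    (fun x y => by simp only [ngP, neg_inj]; rw [eq_comm]; exact hφ' x y)
    oab.symm.neg oab'.symm.neg obb.neg op.neg op'.neg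
    (fun h => ht (neg_lt_neg_iff.1 h)) (fun h => htT (neg_lt_neg_iff.1 h))
    (fun h => ht' (neg_lt_neg_iff.1 h)) (fun h => htT' (neg_lt_neg_iff.1 h))
  simp only [ngP, wt_neg] at this
  rw [← e t, ← e' t'] at this
  refine ⟨this.1, fun hC => this.2 ?_⟩
  intro x
  have := hC x
  simp only [rs, ngP, neg_lt_neg_iff] at this ⊢
  exact ⟨this.2, this.1⟩

theorem cross_sign {f g : ℝ → ℝ} (hf : Continuous f) (hg : Continuous g) {x0 : ℝ}
    (h0 : f x0 = g x0) (hun : ∀ x, f x = g x → x = x0) (h1 : ∃ x, f x < g x) (h2 : ∃ x, g x < f x) :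
    ((∀ x, x < x0 → f x < g x) ∧ (∀ x, x0 < x → g x < f x)) ∨
    ((∀ x, x < x0 → g x < f x) ∧ (∀ x, x0 < x → f x < g x)) := by
  have key : ∀ x y, f x < g x → g y < f y → (x < x0 ∧ x0 < y) ∨ (y < x0 ∧ x0 < x) := by
    intro x y hx hy
    obtain ⟨z, hz, hz'⟩ := ivt_two hf hg hx hy
    rw [hun z hz] at hz'; exact hz'
  obtain ⟨x1, h1⟩ := h1
  obtain ⟨x2, h2⟩ := h2
  rcases key x1 x2 h1 h2 with ⟨a1, a2⟩ | ⟨a1, a2⟩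
  · left
    constructor
    · intro x hx
      rcases lt_trichotomy (f x) (g x) with h | h | h
      · exact h
      · exact absurd (hun x h) hx.ne
      · rcases key x1 x h1 h with h' | h' <;> linarith [h'.1, h'.2]
    · intro x hx
      rcases lt_trichotomy (f x) (g x) with h | h | h
      · rcases key x x2 h h2 with h' | h' <;> linarith [h'.1, h'.2]
      · exact absurd (hun x h) hx.ne'
      · exact h
  · right
    constructor
    · intro x hx
      rcases lt_trichotomy (f x) (g x) with h | h | h
      · rcases key x x2 h h2 with h' | h' <;> linarith [h'.1, h'.2]
      · exact absurd (hun x h) hx.ne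
      · exact h
    · intro x hx
      rcases lt_trichotomy (f x) (g x) with h | h | h
      · exact h
      · exact absurd (hun x h) hx.ne'
      · rcases key x1 x h1 h with h' | h' <;> linarith [h'.1, h'.2]

theorem curve_cross {Λ : Finset PP} (hΛ : PseudoplaneFamily Λ) {a b c : PP} (ha : a ∈ Λ)
    (hb : b ∈ Λ) (hc : c ∈ Λ) (hab : a ≠ b) (hac : a ≠ c) (hbc : b ≠ c) {φ : ℝ → ℝ}
    (hφ : IsGraphFun a b φ) :
    ∃ x0 : ℝ, c x0 (φ x0) = a x0 (φ x0) ∧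
      (∀ x y, a x y = b x y → a x y = c x y → x = x0 ∧ y = φ x0) ∧
      (((∀ x, x < x0 → c x (φ x) < a x (φ x)) ∧ (∀ x, x0 < x → a x (φ x) < c x (φ x))) ∨
       ((∀ x, x < x0 → a x (φ x) < c x (φ x)) ∧ (∀ x, x0 < x → c x (φ x) < a x (φ x)))) := by
  obtain ⟨H1, H2, H3, H4, H5, H6, H7⟩ := hΛ
  obtain ⟨q, ⟨hq1, hq2⟩, hqu⟩ := H3 a ha b hb c hc hab hac hbc
  have hq : q.2 = φ q.1 := (hφ.2 _ _).1 hq1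
  have un : ∀ x y, a x y = b x y → a x y = c x y → x = q.1 ∧ y = φ q.1 := by
    intro x y e1 e2
    have := hqu (x, y) ⟨e1, e2⟩
    rw [← hq, ← this]; exact ⟨rfl, rfl⟩
  refine ⟨q.1, by rw [← hq]; exact hq2.symm, un, ?_⟩
  have cc : ∀ d ∈ Λ, Continuous fun x => d x (φ x) := fun d hd =>
    (H1 d hd).comp (continuous_id.prodMk hφ.1)
  obtain ⟨g1, g2⟩ := H7 a ha b hb c hc hab hac hbc φ hφ
  exact cross_sign (cc c hc) (cc a ha) (by rw [← hq]; exact hq2.symm)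
    (fun x hx => (un x (φ x) ((hφ.2 _ _).2 rfl) hx.symm).1) g1 g2

theorem pair_lemma {Λ : Finset PP} (hΛ : PseudoplaneFamily Λ) (k : ℕ) {a b : PP} (ha : a ∈ Λ)
    (hb : b ∈ Λ) (hab : a ≠ b) {φ : ℝ → ℝ} (hφ : IsGraphFun a b φ) (t : ℝ) (s : ℤ)
    (hs : s = 1 ∨ s = -1) :
    ∑ c ∈ ((Λ.erase a).erase b).filter (fun c => IsKCorridorTriple Λ k {a, b, c}),
      wt s (c t (φ t)) (a t (φ t)) ≤ 2 := by
  set S := (Λ.erase a).erase b with hS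
  have hmem : ∀ c ∈ S, c ∈ Λ ∧ a ≠ c ∧ b ≠ c := by
    intro c hc
    simp only [hS, Finset.mem_erase] at hc
    exact ⟨hc.2.2, Ne.symm hc.2.1, Ne.symm hc.1⟩
  have ex : ∀ c : PP, ∃ x0 : ℝ, ∃ e : ℤ, c ∈ S → (c x0 (φ x0) = a x0 (φ x0) ∧
      (∀ x y, a x y = b x y → a x y = c x y → x = x0 ∧ y = φ x0) ∧
      ((e = 1 ∧ (∀ x, x < x0 → c x (φ x) < a x (φ x)) ∧ (∀ x, x0 < x → a x (φ x) < c x (φ x))) ∨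
       (e = -1 ∧ (∀ x, x < x0 → a x (φ x) < c x (φ x)) ∧
        (∀ x, x0 < x → c x (φ x) < a x (φ x))))) := by
    intro c
    by_cases hc : c ∈ S
    · obtain ⟨m1, m2, m3⟩ := hmem c hc
      obtain ⟨x0, e1, e2, h | h⟩ := curve_cross hΛ ha hb m1 hab m2 m3 hφ
      · exact ⟨x0, 1, fun _ => ⟨e1, e2, Or.inl ⟨rfl, h⟩⟩⟩
      · exact ⟨x0, -1, fun _ => ⟨e1, e2, Or.inr ⟨rfl, h⟩⟩⟩
    · exact ⟨0, 0, fun h => absurd h hc⟩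
  choose X E hXE using ex
  let lev : PP → ℕ := fun c => level Λ (X c) (φ (X c)) (a (X c) (φ (X c)))
  have hab0 : ∀ x, a x (φ x) = b x (φ x) := fun x => (hφ.2 _ _).2 rfl
  have hiff : ∀ c ∈ S, (IsKCorridorTriple Λ k {a, b, c} ↔ lev c = k) := by
    intro c hc
    obtain ⟨z1, z2, z3⟩ := hXE c hc
    constructor
    · rintro ⟨x, y, z, h1, h2⟩
      have e1 := h1 a (by simp)
      have e2 := h1 b (by simp)
      have e3 := h1 c (by simp)
      obtain ⟨rfl, rfl⟩ := z2 x y (by rw [e1, e2]) (by rw [e1, e3])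
      simp only [lev]; rw [e1]; exact h2
    · intro h
      refine ⟨X c, φ (X c), a (X c) (φ (X c)), ?_, h⟩
      intro d hd
      simp only [Finset.mem_insert, Finset.mem_singleton] at hd
      rcases hd with rfl | rfl | rfl
      · rfl
      · exact (hab0 _).symm
      · exact z1
  rw [Finset.filter_congr hiff]
  have hx : ∀ c ∈ S, ∀ d ∈ S, X c = X d → c = d := by
    intro c hc d hd h
    by_contra hcd
    obtain ⟨m1, m2, m3⟩ := hmem c hc
    obtain ⟨m1', m2', m3'⟩ := hmem d hd
    refine hΛ.2.2.2.2.1 a ha b hb c m1 d m1' hab m2 m2' m3 m3' hcd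
      ⟨X c, φ (X c), hab0 _, (hXE c hc).1.symm, ?_⟩
    rw [h]; exact (hXE d hd).1.symm
  refine comb_pair S X E k hx ?_ lev ?_ t s hs _ ?_ ?_ ?_
  · intro c hc
    rcases (hXE c hc).2.2 with h | h
    · exact Or.inl h.1
    · exact Or.inr h.1
  · intro c hc
    simp only [lev, level]
    congr 1
    ext d
    simp only [Finset.mem_filter]
    constructor
    · rintro ⟨hd, hlt⟩
      have hda : d ≠ a := by rintro rfl; exact lt_irrefl _ hlt
      have hdb : d ≠ b := by rintro rfl; rw [hab0] at hlt; exact lt_irrefl _ hlt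
      have hdS : d ∈ S := by simp [hS, hda, hdb, hd]
      refine ⟨hdS, ?_⟩
      obtain ⟨z1, z2, z3⟩ := hXE d hdS
      rcases lt_trichotomy (X d) (X c) with h | h | h
      · rcases z3 with ⟨z, z4, z5⟩ | ⟨z, z4, z5⟩
        · have := z5 _ h; linarith
        · exact Or.inl ⟨h, z⟩
      · rw [← h] at hlt; linarith
      · rcases z3 with ⟨z, z4, z5⟩ | ⟨z, z4, z5⟩
        · exact Or.inr ⟨h, z⟩
        · have := z4 _ h; linarith
    · rintro ⟨hdS, h⟩
      refine ⟨(hmem d hdS).1, ?_⟩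
      obtain ⟨z1, z2, z3⟩ := hXE d hdS
      rcases h with ⟨h, h'⟩ | ⟨h, h'⟩
      · rcases z3 with ⟨z, z4, z5⟩ | ⟨z, z4, z5⟩
        · omega
        · exact z5 _ h
      · rcases z3 with ⟨z, z4, z5⟩ | ⟨z, z4, z5⟩
        · exact z4 _ h
        · omega
  · intro c hc h
    obtain ⟨z1, z2, ⟨z, z4, z5⟩ | ⟨z, z4, z5⟩⟩ := hXE c hc
    · rw [wt_gt (z5 _ h), z]; ring
    · rw [wt_lt (z5 _ h), z]; ring
  · intro c hc h
    obtain ⟨z1, z2, ⟨z, z4, z5⟩ | ⟨z, z4, z5⟩⟩ := hXE c hc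
    · rw [wt_lt (z4 _ h), z]; ring
    · rw [wt_gt (z4 _ h), z]; ring
  · intro c hc h
    obtain ⟨z1, z2, z3⟩ := hXE c hc
    rw [← h]; exact wt_eq z1

theorem perm_a {α : Type} (p q r : α) : ({p, q, r} : Finset α) = {p, r, q} := by
  ext z; simp only [Finset.mem_insert, Finset.mem_singleton]; tauto

theorem perm_b {α : Type} (p q r : α) : ({p, q, r} : Finset α) = {q, p, r} := by
  ext z; simp only [Finset.mem_insert, Finset.mem_singleton]; tauto

theorem count_lemma {α : Type} (L X Y : Finset α) (K : Finset (Finset α)) (W : α → α → α → ℤ)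
    (Q : Finset α → Prop) (hXL : X ⊆ L) (hYL : Y ⊆ L) (hdis : ∀ a ∈ X, a ∉ Y)
    (hun : ∀ a ∈ L, a ∈ X ∨ a ∈ Y) (hK : ∀ s ∈ K, s ⊆ L ∧ s.card = 3)
    (pair : ∀ a ∈ X, ∀ b ∈ Y,
      ∑ c ∈ ((L.erase a).erase b).filter (fun c => ({a, b, c} : Finset α) ∈ K), W a b c ≤ 2)
    (xxy : ∀ a ∈ X, ∀ a' ∈ X, ∀ b ∈ Y, a ≠ a' → 0 ≤ W a b a' + W a' b a ∧
      (Q {a, a', b} → 2 ≤ W a b a' + W a' b a))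
    (xyy : ∀ a ∈ X, ∀ b ∈ Y, ∀ b' ∈ Y, b ≠ b' → 0 ≤ W a b b' + W a b' b ∧
      (Q {a, b, b'} → 2 ≤ W a b b' + W a b' b))
    (hx : ∀ s ∈ K, s ⊆ X → ¬ Q s) (hy : ∀ s ∈ K, s ⊆ Y → ¬ Q s) :
    (K.filter Q).card ≤ X.card * Y.card := by
  let st : (α × α) × α → Finset α := fun i => {i.1.1, i.1.2, i.2}
  let J : Finset ((α × α) × α) :=
    ((X ×ˢ Y) ×ˢ L).filter fun i => i.2 ≠ i.1.1 ∧ i.2 ≠ i.1.2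
  let w : (α × α) × α → ℤ := fun i => W i.1.1 i.1.2 i.2
  let f : Finset α → ℤ := fun s => ∑ i ∈ J with st i = s, w i
  have fxxy : ∀ a ∈ X, ∀ a' ∈ X, ∀ b ∈ Y, a ≠ a' →
      f {a, a', b} = W a b a' + W a' b a := by
    intro a ha a' ha' b hb hne
    have : (J.filter fun i => st i = {a, a', b}) = {((a, b), a'), ((a', b), a)} := by
      have n1 : a ≠ b := fun h => hdis a ha (h ▸ hb)
      have n2 : a' ≠ b := fun h => hdis a' ha' (h ▸ hb)
      ext ⟨⟨p, q⟩, c⟩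
      simp only [J, st, Finset.mem_filter, Finset.mem_product, Finset.mem_insert,
        Finset.mem_singleton, Prod.mk.injEq]
      constructor
      · rintro ⟨⟨⟨⟨hp, hq⟩, hc⟩, h1, h2⟩, hs⟩
        have m1 : p ∈ ({a, a', b} : Finset α) := by rw [← hs]; simp
        have m2 : q ∈ ({a, a', b} : Finset α) := by rw [← hs]; simp
        have m3 : c ∈ ({a, a', b} : Finset α) := by rw [← hs]; simp
        simp only [Finset.mem_insert, Finset.mem_singleton] at m1 m2 m3
        have q1 : q = b := by
          rcases m2 with rfl | rfl | h
          · exact absurd hq (hdis _ ha)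
          · exact absurd hq (hdis _ ha')
          · exact h
        have p1 : p ≠ b := fun h => hdis p hp (h ▸ hb)
        subst q1
        rcases m1 with h | h | h
        · rcases m3 with h' | h' | h'
          · exact absurd (h'.trans h.symm) h1
          · exact Or.inl ⟨⟨h, rfl⟩, h'⟩
          · exact absurd h' h2
        · rcases m3 with h' | h' | h'
          · exact Or.inr ⟨⟨h, rfl⟩, h'⟩
          · exact absurd (h'.trans h.symm) h1
          · exact absurd h' h2
        · exact absurd h p1
      · rintro (⟨⟨rfl, rfl⟩, rfl⟩ | ⟨⟨rfl, rfl⟩, rfl⟩)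
        · refine ⟨⟨⟨⟨ha, hb⟩, hXL ha'⟩, hne.symm, n2⟩, ?_⟩
          exact perm_a _ _ _
        · refine ⟨⟨⟨⟨ha', hb⟩, hXL ha⟩, hne, n1⟩, ?_⟩
          rw [perm_a, perm_b]
    simp only [f]
    rw [this, Finset.sum_pair]
    intro h
    simp only [Prod.mk.injEq] at h
    exact hne h.2.symm
  have fxyy : ∀ a ∈ X, ∀ b ∈ Y, ∀ b' ∈ Y, b ≠ b' →
      f {a, b, b'} = W a b b' + W a b' b := by
    intro a ha b hb b' hb' hne
    have : (J.filter fun i => st i = {a, b, b'}) = {((a, b), b'), ((a, b'), b)} := by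
      have n1 : a ≠ b := fun h => hdis a ha (h ▸ hb)
      have n2 : a ≠ b' := fun h => hdis a ha (h ▸ hb')
      ext ⟨⟨p, q⟩, c⟩
      simp only [J, st, Finset.mem_filter, Finset.mem_product, Finset.mem_insert,
        Finset.mem_singleton, Prod.mk.injEq]
      constructor
      · rintro ⟨⟨⟨⟨hp, hq⟩, hc⟩, h1, h2⟩, hs⟩
        have m1 : p ∈ ({a, b, b'} : Finset α) := by rw [← hs]; simp
        have m2 : q ∈ ({a, b, b'} : Finset α) := by rw [← hs]; simp
        have m3 : c ∈ ({a, b, b'} : Finset α) := by rw [← hs]; simp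
        simp only [Finset.mem_insert, Finset.mem_singleton] at m1 m2 m3
        have q1 : p = a := by
          rcases m1 with h | rfl | rfl
          · exact h
          · exact absurd hb (hdis _ hp)
          · exact absurd hb' (hdis _ hp)
        have p1 : q ≠ a := fun h => hdis a ha (h ▸ hq)
        subst q1
        rcases m2 with h | h | h
        · exact absurd h p1
        · rcases m3 with h' | h' | h'
          · exact absurd h' h1
          · exact absurd (h'.trans h.symm) h2
          · exact Or.inl ⟨⟨rfl, h⟩, h'⟩
        · rcases m3 with h' | h' | h'
          · exact absurd h' h1
          · exact Or.inr ⟨⟨rfl, h⟩, h'⟩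
          · exact absurd (h'.trans h.symm) h2
      · rintro (⟨⟨rfl, rfl⟩, rfl⟩ | ⟨⟨rfl, rfl⟩, rfl⟩)
        · exact ⟨⟨⟨⟨ha, hb⟩, hYL hb'⟩, n2.symm, hne.symm⟩, rfl⟩
        · refine ⟨⟨⟨⟨ha, hb'⟩, hYL hb⟩, n1.symm, hne⟩, ?_⟩
          exact perm_a _ _ _
    simp only [f]
    rw [this, Finset.sum_pair]
    intro h
    simp only [Prod.mk.injEq] at h
    exact hne h.2.symm
  have P1 : ∀ a ∈ X, ∀ a' ∈ X, ∀ b ∈ Y, a ≠ a' → ∀ s : Finset α, s = {a, a', b} →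
      0 ≤ f s ∧ (Q s → 2 ≤ f s) := by
    rintro a ha a' ha' b hb hne s rfl
    rw [fxxy a ha a' ha' b hb hne]
    exact xxy a ha a' ha' b hb hne
  have P2 : ∀ a ∈ X, ∀ b ∈ Y, ∀ b' ∈ Y, b ≠ b' → ∀ s : Finset α, s = {a, b, b'} →
      0 ≤ f s ∧ (Q s → 2 ≤ f s) := by
    rintro a ha b hb b' hb' hne s rfl
    rw [fxyy a ha b hb b' hb' hne]
    exact xyy a ha b hb b' hb' hne
  have P : ∀ s ∈ K, 0 ≤ f s ∧ (Q s → 2 ≤ f s) := by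
    intro s hs
    obtain ⟨hsL, hs3⟩ := hK s hs
    by_cases hX : s ⊆ X
    · refine ⟨?_, fun h => absurd h (hx s hs hX)⟩
      apply le_of_eq
      symm
      refine Finset.sum_eq_zero fun i hi => ?_
      exfalso
      simp only [J, st, Finset.mem_filter, Finset.mem_product] at hi
      have : i.1.2 ∈ s := by rw [← hi.2]; simp
      exact hdis _ (hX this) hi.1.1.1.2
    by_cases hY : s ⊆ Y
    · refine ⟨?_, fun h => absurd h (hy s hs hY)⟩
      apply le_of_eq
      symm
      refine Finset.sum_eq_zero fun i hi => ?_
      exfalso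
      simp only [J, st, Finset.mem_filter, Finset.mem_product] at hi
      have : i.1.1 ∈ s := by rw [← hi.2]; simp
      exact hdis _ hi.1.1.1.1 (hY this)
    obtain ⟨p, q, r, hpq, hpr, hqr, rfl⟩ := Finset.card_eq_three.1 hs3
    have p1 := hun p (hsL (by simp))
    have q1 := hun q (hsL (by simp))
    have r1 := hun r (hsL (by simp))
    have t1 : ({p, q, r} : Finset α) = {p, r, q} := perm_a _ _ _
    have t2 : ({p, q, r} : Finset α) = {q, r, p} := (perm_b _ _ _).trans (perm_a _ _ _)
    have t3 : ({p, q, r} : Finset α) = {q, p, r} := perm_b _ _ _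
    have t4 : ({p, q, r} : Finset α) = {r, p, q} := (perm_a _ _ _).trans (perm_b _ _ _)
    rcases p1 with p1 | p1 <;> rcases q1 with q1 | q1 <;> rcases r1 with r1 | r1
    · exact absurd (by intro z hz; simp only [Finset.mem_insert, Finset.mem_singleton] at hz
                       rcases hz with rfl | rfl | rfl <;> assumption) hX
    · exact P1 p p1 q q1 r r1 hpq _ rfl
    · exact P1 p p1 r r1 q q1 hpr _ t1
    · exact P2 p p1 q q1 r r1 hqr _ rfl
    · exact P1 q q1 r r1 p p1 hqr _ t2
    · exact P2 q q1 p p1 r r1 hpr _ t3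
    · exact P2 r r1 p p1 q q1 hpq _ t4
    · exact absurd (by intro z hz; simp only [Finset.mem_insert, Finset.mem_singleton] at hz
                       rcases hz with rfl | rfl | rfl <;> assumption) hY
  have lower : 2 * ((K.filter Q).card : ℤ) ≤ ∑ s ∈ K, f s := by
    calc 2 * ((K.filter Q).card : ℤ) = ∑ s ∈ K.filter Q, (2 : ℤ) := by simp [mul_comm]
      _ ≤ ∑ s ∈ K.filter Q, f s := by
        refine Finset.sum_le_sum fun s hs => ?_
        rw [Finset.mem_filter] at hs
        exact (P s hs.1).2 hs.2
      _ ≤ ∑ s ∈ K, f s :=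
        Finset.sum_le_sum_of_subset_of_nonneg (Finset.filter_subset _ _)
          (fun s hs _ => (P s hs).1)
  have eq1 : ∑ s ∈ K, f s = ∑ i ∈ J.filter (fun i => st i ∈ K), w i := by
    rw [← Finset.sum_fiberwise_of_maps_to (s := J.filter (fun i => st i ∈ K)) (t := K) (g := st)
      (fun i hi => (Finset.mem_filter.1 hi).2)]
    refine Finset.sum_congr rfl fun s hs => ?_
    simp only [f]
    refine Finset.sum_congr ?_ fun _ _ => rfl
    ext i
    simp only [Finset.mem_filter]
    constructor
    · rintro ⟨h1, h2⟩; exact ⟨⟨h1, h2 ▸ hs⟩, h2⟩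
    · rintro ⟨⟨h1, _⟩, h2⟩; exact ⟨h1, h2⟩
  have eq2 : ∑ i ∈ J.filter (fun i => st i ∈ K), w i ≤ ∑ p ∈ X ×ˢ Y, (2 : ℤ) := by
    simp only [J]
    rw [Finset.filter_filter, Finset.sum_filter, Finset.sum_product]
    refine Finset.sum_le_sum fun p hp => ?_
    rw [Finset.mem_product] at hp
    refine le_trans (le_of_eq ?_) (pair p.1 hp.1 p.2 hp.2)
    rw [← Finset.sum_filter]
    refine Finset.sum_congr ?_ fun _ _ => rfl
    ext c
    simp only [st, Finset.mem_filter, Finset.mem_erase]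
    constructor
    · rintro ⟨h1, ⟨h2, h3⟩, h4⟩; exact ⟨⟨h3, h2, h1⟩, h4⟩
    · rintro ⟨⟨h3, h2, h1⟩, h4⟩; exact ⟨h1, ⟨h2, h3⟩, h4⟩
  have := lower.trans (eq1.le.trans eq2)
  simp only [Finset.sum_const, Finset.card_product, nsmul_eq_mul] at this
  push_cast at this
  have h : ((K.filter Q).card : ℤ) ≤ (X.card : ℤ) * Y.card := by linarith
  exact_mod_cast h

theorem bound_lemma {ι : Type} (F : Finset ι) (f : ι → ℝ) : ∃ M : ℝ, ∀ i ∈ F, |f i| ≤ M := by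
  obtain ⟨M, hM⟩ := (F.image fun i => |f i|).exists_le
  exact ⟨M, fun i hi => hM _ (Finset.mem_image_of_mem _ hi)⟩

theorem arith_lemma (x y n : ℕ) (h : x + y ≤ n) : x * y ≤ n * (n - 1) / 2 := by
  rw [Nat.le_div_iff_mul_le (by norm_num)]
  rcases n with _ | m
  · have : x = 0 := by omega
    simp [this]
  · simp only [Nat.add_sub_cancel]
    rcases Nat.eq_zero_or_pos x with rfl | hx
    · simp
    rcases Nat.eq_zero_or_pos y with rfl | hy
    · simp
    obtain ⟨x, rfl⟩ := Nat.exists_eq_add_of_le' hx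
    have hm : x + y ≤ m := by omega
    have : (x + 1 + y) * (x + y) ≤ (m + 1) * m := Nat.mul_le_mul (by omega) hm
    nlinarith [Nat.le_mul_self x, Nat.le_mul_self y, sq_nonneg ((x:ℤ) - y)]

/-- The sign attached to a pair `a` (above at `-T`), `b` (below at `-T`). -/
def sg (T : ℝ) (u v : ℝ → ℝ) (xt : PP → ℝ) (Y : Finset PP) (a b : PP) : ℤ :=
  if v T < rs u a T then
    (if v T < rs u b T then 1
     else if xt a < xt b ∨ (xt a = xt b ∧ ∃ c ∈ Y, v T < rs u c T ∧ xt c = xt a) then 1 else -1)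
  else
    (if rs u b T < v T then -1 else if xt b < xt a then 1 else -1)

theorem sg_rule (T : ℝ) (u v : ℝ → ℝ) (xt : PP → ℝ) (Y : Finset PP) (a b : PP) :
    Rule T (rs u a) (rs u b) v (xt a) (xt b) (sg T u v xt Y a b) := by
  refine ⟨?_, ?_, ?_, ?_, ?_⟩
  · unfold sg; split_ifs <;> simp
  · intro h1 h2; simp [sg, h1, h2]
  · intro h1 h2; simp [sg, h2, not_lt.2 h1.le]
  · intro h1 h2
    constructor
    · intro h; simp [sg, not_lt.2 h1.le, not_lt.2 h2.le, h]
    · intro h; simp [sg, not_lt.2 h1.le, not_lt.2 h2.le, not_lt.2 h.le]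
  · intro h1 h2
    constructor
    · intro h; simp [sg, h1, not_lt.2 h2.le, h]
    · intro h; simp [sg, h1, not_lt.2 h2.le, not_lt.2 h.le, h.ne']

theorem main_bound (Λ : Finset PP) (k : ℕ) (hΛ : PseudoplaneFamily Λ)
    (u v : ℝ → ℝ) (hu : Continuous u) (hv : Continuous v)
    (h1 : ∀ a ∈ Λ, ∃! x : ℝ, v x = a x (u x))
    (h2 : ∀ a ∈ Λ, ∀ b ∈ Λ, a ≠ b → ∀ φ : ℝ → ℝ, IsGraphFun a b φ →
      {x : ℝ | u x = φ x}.Subsingleton) :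
    ((kCorridors Λ k).filter fun s =>
        {p : ℝ × ℝ × ℝ | ∃ x : ℝ, p = (x, u x, v x)} ⊆ corridorSet s).card
      ≤ Λ.card * (Λ.card - 1) / 2 := by
  have hΛ' := hΛ
  obtain ⟨H1, H2, H3, H4, H5, H6, H7⟩ := hΛ
  -- intersection curves
  have exφ : ∀ a b : PP, ∃ φ : ℝ → ℝ, a ∈ Λ → b ∈ Λ → a ≠ b → IsGraphFun a b φ := by
    intro a b
    by_cases h : a ∈ Λ ∧ b ∈ Λ ∧ a ≠ b
    · obtain ⟨φ, hφ⟩ := H2 a h.1 b h.2.1 h.2.2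
      exact ⟨φ, fun _ _ _ => hφ⟩
    · exact ⟨fun _ => 0, fun x y z => absurd ⟨x, y, z⟩ h⟩
  choose φ hφ using exφ
  -- touching times
  have exx : ∀ a : PP, ∃ x : ℝ, a ∈ Λ → v x = a x (u x) ∧ ∀ y, v y = a y (u y) → y = x := by
    intro a
    by_cases h : a ∈ Λ
    · obtain ⟨x, hx, hx'⟩ := h1 a h
      exact ⟨x, fun _ => ⟨hx, hx'⟩⟩
    · exact ⟨0, fun h' => absurd h' h⟩
  choose xt hxt using exx
  -- meeting times
  have exm : ∀ a b : PP, ∃ m : ℝ, a ∈ Λ → b ∈ Λ → a ≠ b →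
      ∀ x, rs u a x = rs u b x → x = m := by
    intro a b
    by_cases h : ∃ m, rs u a m = rs u b m
    · obtain ⟨m, hm⟩ := h
      refine ⟨m, fun ha hb hab x hx => ?_⟩
      have hf := hφ a b ha hb hab
      exact h2 a ha b hb hab _ hf ((hf.2 _ _).1 hx) ((hf.2 _ _).1 hm)
    · exact ⟨0, fun _ _ _ x hx => absurd ⟨x, hx⟩ h⟩
  choose m hm using exm
  -- crossings on curves
  have exz : ∀ a b c : PP, ∃ x0 : ℝ, a ∈ Λ → b ∈ Λ → c ∈ Λ → a ≠ b → a ≠ c → b ≠ c →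
      (((∀ x, x < x0 → c x (φ a b x) < a x (φ a b x)) ∧
        (∀ x, x0 < x → a x (φ a b x) < c x (φ a b x))) ∨
       ((∀ x, x < x0 → a x (φ a b x) < c x (φ a b x)) ∧
        (∀ x, x0 < x → c x (φ a b x) < a x (φ a b x)))) := by
    intro a b c
    by_cases h : a ∈ Λ ∧ b ∈ Λ ∧ c ∈ Λ ∧ a ≠ b ∧ a ≠ c ∧ b ≠ c
    · obtain ⟨ha, hb, hc, hab, hac, hbc⟩ := h
      obtain ⟨x0, _, _, hh⟩ := curve_cross hΛ' ha hb hc hab hac hbc (hφ a b ha hb hab)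
      exact ⟨x0, fun _ _ _ _ _ _ => hh⟩
    · exact ⟨0, fun x1 x2 x3 x4 x5 x6 => absurd ⟨x1, x2, x3, x4, x5, x6⟩ h⟩
  choose z hz using exz
  obtain ⟨M1, hM1⟩ := bound_lemma Λ xt
  obtain ⟨M2, hM2⟩ := bound_lemma (Λ ×ˢ Λ) (fun p => m p.1 p.2)
  obtain ⟨M3, hM3⟩ := bound_lemma (Λ ×ˢ Λ ×ˢ Λ) (fun p => z p.1 p.2.1 p.2.2)
  obtain ⟨T, hT0, hT1, hT2, hT3⟩ : ∃ T : ℝ, 0 < T ∧ M1 < T ∧ M2 < T ∧ M3 < T := by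
    refine ⟨|M1| + |M2| + |M3| + 1, ?_, ?_, ?_, ?_⟩ <;>
    linarith [abs_nonneg M1, abs_nonneg M2, abs_nonneg M3, le_abs_self M1, le_abs_self M2,
      le_abs_self M3]
  have crs : ∀ a ∈ Λ, Continuous (rs u a) := fun a ha => (H1 a ha).comp (continuous_id.prodMk hu)
  have hOv : ∀ a ∈ Λ, Once T (rs u a) v := by
    intro a ha
    refine ⟨crs a ha, hv, ?_, ?_⟩
    · intro x y hx hy
      rw [(hxt a ha).2 x hx.symm, (hxt a ha).2 y hy.symm]
    · intro x hx
      rw [(hxt a ha).2 x hx.symm]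
      exact abs_lt.1 (lt_of_le_of_lt (hM1 a ha) hT1)
  have hO : ∀ a ∈ Λ, ∀ b ∈ Λ, a ≠ b → Once T (rs u a) (rs u b) := by
    intro a ha b hb hab
    refine ⟨crs a ha, crs b hb, ?_, ?_⟩
    · intro x y hx hy
      rw [hm a b ha hb hab x hx, hm a b ha hb hab y hy]
    · intro x hx
      rw [hm a b ha hb hab x hx]
      exact abs_lt.1 (lt_of_le_of_lt (hM2 (a, b) (Finset.mk_mem_product ha hb)) hT2)
  have hOr : ∀ a ∈ Λ, ∀ b ∈ Λ, a ≠ b → OrP a b := fun a ha b hb hab =>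
    orP_of (H1 a ha) (H1 b hb) (hφ a b ha hb hab) (H6 a ha b hb hab)
  have hOpp : ∀ a ∈ Λ, ∀ b ∈ Λ, ∀ c ∈ Λ, a ≠ b → a ≠ c → b ≠ c →
      Opp c a T (φ a b T) (-T) (φ a b (-T)) := by
    intro a ha b hb c hc hab hac hbc
    have hb3 := abs_lt.1 (lt_of_le_of_lt (hM3 (a, b, c)
      (Finset.mk_mem_product ha (Finset.mk_mem_product hb hc))) hT3)
    rcases hz a b c ha hb hc hab hac hbc with h | h
    · exact Or.inr ⟨h.2 _ hb3.2, h.1 _ hb3.1⟩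
    · exact Or.inl ⟨h.2 _ hb3.2, h.1 _ hb3.1⟩
  -- the two classes
  let X : Finset PP := Λ.filter fun a => v (-T) < rs u a (-T)
  let Y : Finset PP := Λ.filter fun a => rs u a (-T) < v (-T)
  have mX : ∀ a ∈ X, a ∈ Λ ∧ v (-T) < rs u a (-T) := fun a ha => Finset.mem_filter.1 ha
  have mY : ∀ a ∈ Y, a ∈ Λ ∧ rs u a (-T) < v (-T) := fun a ha => Finset.mem_filter.1 ha
  have hXY : ∀ a ∈ X, ∀ b ∈ Y, a ≠ b := by
    rintro a ha b hb rfl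
    exact lt_irrefl _ ((mX a ha).2.trans (mY a hb).2)
  have ext : ∀ a b : PP, ∃ t : ℝ, a ∈ X → b ∈ Y →
      (rs u a T < rs u b T → u t = φ a b t) ∧ (rs u b T < rs u a T → t = T) := by
    intro a b
    by_cases h : a ∈ X ∧ b ∈ Y ∧ rs u a T < rs u b T
    · obtain ⟨ha, hb, hlt⟩ := h
      have hab := hXY a ha b hb
      obtain ⟨t, ht, _, _⟩ := (hO a (mX a ha).1 b (mY b hb).1 hab).meet hT0
        ((mY b hb).2.trans (mX a ha).2) hlt
      refine ⟨t, fun _ _ => ⟨fun _ => ?_, fun h => absurd h (not_lt.2 hlt.le)⟩⟩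
      exact ((hφ a b (mX a ha).1 (mY b hb).1 hab).2 _ _).1 ht
    · exact ⟨T, fun ha hb => ⟨fun hlt => absurd ⟨ha, hb, hlt⟩ h, fun _ => rfl⟩⟩
  choose τ hτ using ext
  let σ : PP → PP → ℤ := sg T u v xt Y
  have rule : ∀ a b, Rule T (rs u a) (rs u b) v (xt a) (xt b) (σ a b) :=
    fun a b => sg_rule T u v xt Y a b
  have xtz : ∀ a ∈ Λ, rs u a (xt a) = v (xt a) := fun a ha => (hxt a ha).1.symm
  let W : PP → PP → PP → ℤ := fun a b c =>
    wt (σ a b) (c (τ a b) (φ a b (τ a b))) (a (τ a b) (φ a b (τ a b)))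
  let Q : Finset PP → Prop := fun s =>
    {p : ℝ × ℝ × ℝ | ∃ x : ℝ, p = (x, u x, v x)} ⊆ corridorSet s
  have hQ : ∀ s, Q s → ∀ x, (∃ a ∈ s, rs u a x < v x) ∧ (∃ a ∈ s, v x < rs u a x) := by
    intro s hs x
    exact hs (⟨x, rfl⟩ : (x, u x, v x) ∈ {p : ℝ × ℝ × ℝ | ∃ x : ℝ, p = (x, u x, v x)})
  have hQ3 : ∀ a b c : PP, Q {a, b, c} → Cntd (rs u a) (rs u b) (rs u c) v := by
    intro a b c h x
    have := hQ _ h x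
    simpa using this
  have hno : ∀ a ∈ X, ∀ a' ∈ X, ∀ b ∈ Y, a ≠ a' → rs u b T < v T → xt a = xt b → xt a' = xt b →
      ¬ ∃ c ∈ Y, v T < rs u c T ∧ xt c = xt a := by
    rintro a ha a' ha' b hb hne hbT e1 e2 ⟨c, hc, hcT, e3⟩
    have hbc : b ≠ c := by rintro rfl; linarith
    refine H5 a (mX a ha).1 a' (mX a' ha').1 b (mY b hb).1 c (mY c hc).1 hne (hXY a ha b hb)
      (hXY a ha c hc) (hXY a' ha' b hb) (hXY a' ha' c hc) hbc ⟨xt a, u (xt a), ?_, ?_, ?_⟩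
    · rw [← (hxt a (mX a ha).1).1, show xt a = xt a' from e1.trans e2.symm]
      exact (hxt a' (mX a' ha').1).1
    · rw [← (hxt a (mX a ha).1).1, e1]
      exact (hxt b (mY b hb).1).1
    · rw [← (hxt a (mX a ha).1).1, ← e3]
      exact (hxt c (mY c hc).1).1
  have key : ((kCorridors Λ k).filter Q).card ≤ X.card * Y.card := by
    refine count_lemma Λ X Y (kCorridors Λ k) W Q (Finset.filter_subset _ _)
      (Finset.filter_subset _ _) (fun a ha hb => hXY a ha a hb rfl) ?_ ?_ ?_ ?_ ?_ ?_ ?_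
    · intro a ha
      rcases lt_or_gt_of_ne (hOv a ha).ne_nT with h | h
      · exact Or.inr (Finset.mem_filter.2 ⟨ha, h⟩)
      · exact Or.inl (Finset.mem_filter.2 ⟨ha, h⟩)
    · intro s hs
      exact Finset.mem_powersetCard.1 (Finset.mem_filter.1 hs).1
    · intro a ha b hb
      have hab := hXY a ha b hb
      have haL := (mX a ha).1
      have hbL := (mY b hb).1
      have := pair_lemma hΛ' k haL hbL hab (hφ a b haL hbL hab) (τ a b) (σ a b) (rule a b).1
      refine le_trans (le_of_eq ?_) this
      refine Finset.sum_congr (Finset.filter_congr fun c hc => ?_) fun _ _ => rfl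
      simp only [Finset.mem_erase] at hc
      simp only [kCorridors, Finset.mem_filter, Finset.mem_powersetCard]
      refine ⟨fun h => h.2, fun h => ⟨⟨?_, ?_⟩, h⟩⟩
      · intro d hd
        simp only [Finset.mem_insert, Finset.mem_singleton] at hd
        rcases hd with rfl | rfl | rfl
        · exact haL
        · exact hbL
        · exact hc.2.2
      · exact Finset.card_eq_three.2 ⟨a, b, c, hab, Ne.symm hc.2.1, Ne.symm hc.1, rfl⟩
    · intro a ha a' ha' b hb hne
      have hab := hXY a ha b hb
      have hab' := hXY a' ha' b hb
      have haL := (mX a ha).1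
      have haL' := (mX a' ha').1
      have hbL := (mY b hb).1
      have := tri_xxy (s := σ a b) (s' := σ a' b) (t := τ a b) (t' := τ a' b)
        (φ := φ a b) (φ' := φ a' b) hT0 (hOv a haL) (hOv a' haL') (hOv b hbL)
        (hO a haL a' haL' hne) (hO a haL b hbL hab) (hO a' haL' b hbL hab')
        (mX a ha).2 (mX a' ha').2 (mY b hb).2 (xtz a haL) (xtz a' haL') (xtz b hbL)
        (rule a b) (rule a' b)
        (by
          intro g1 g2 g3 e1 e2
          have := hno a ha a' ha' b hb hne g2 e1 e2
          simp only [σ, sg, if_pos g1, if_neg (not_lt.2 g2.le)]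
          rw [if_neg]
          rintro (h | h)
          · linarith
          · exact this h.2)
        (by
          intro g1 g2 g3 e1 e2
          have := hno a' ha' a ha b hb hne.symm g2 e1 e2
          simp only [σ, sg, if_pos g1, if_neg (not_lt.2 g2.le)]
          rw [if_neg]
          rintro (h | h)
          · linarith
          · exact this h.2)
        (by
          intro g1 g2 g3 e1 e2
          simp only [σ, sg, if_pos g1, if_pos g2, e1, e2])
        (hφ a b haL hbL hab).2 (hφ a' b haL' hbL hab').2
        (hOr a haL b hbL hab) (hOr a' haL' b hbL hab') (hOr a haL a' haL' hne)
        (hOpp a haL b hbL a' haL' hab hne hab'.symm)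
        (hOpp a' haL' b hbL a haL hab' hne.symm hab.symm)
        (hτ a b ha hb).1 (hτ a b ha hb).2 (hτ a' b ha' hb).1 (hτ a' b ha' hb).2
      exact ⟨this.1, fun h => this.2 (hQ3 _ _ _ h)⟩
    · intro a ha b hb b' hb' hne
      have hab := hXY a ha b hb
      have hab' := hXY a ha b' hb'
      have haL := (mX a ha).1
      have hbL := (mY b hb).1
      have hbL' := (mY b' hb').1
      have ea : ∀ x, a x (φ a b x) = b x (φ a b x) := fun x =>
        ((hφ a b haL hbL hab).2 _ _).2 rfl
      have ea' : ∀ x, a x (φ a b' x) = b' x (φ a b' x) := fun x =>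
        ((hφ a b' haL hbL' hab').2 _ _).2 rfl
      have op := hOpp a haL b hbL b' hbL' hab hab' hne
      have op' := hOpp a haL b' hbL' b hbL hab' hab hne.symm
      simp only [Opp, ea] at op
      simp only [Opp, ea'] at op'
      have := tri_xyy (s := σ a b) (s' := σ a b') (t := τ a b) (t' := τ a b')
        (φ := φ a b) (φ' := φ a b') hT0 (hOv a haL) (hOv b hbL) (hOv b' hbL')
        (hO b hbL b' hbL' hne) (hO a haL b hbL hab) (hO a haL b' hbL' hab')
        (mX a ha).2 (mY b hb).2 (mY b' hb').2 (xtz a haL) (xtz b hbL) (xtz b' hbL')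
        (rule a b) (rule a b')
        (by
          intro g1 g2 g3 e1 e2
          simp only [σ, sg, if_pos g2, if_neg (not_lt.2 g1.le)]
          rw [if_pos]
          exact Or.inr ⟨e1.symm, b', hb', g3, e2⟩)
        (by
          intro g1 g2 g3 e1 e2
          simp only [σ, sg, if_pos g2, if_neg (not_lt.2 g1.le)]
          rw [if_pos]
          exact Or.inr ⟨e1.symm, b, hb, g3, e2⟩)
        (by
          intro g1 g2 g3 e1 e2
          simp only [σ, sg, if_pos g3, if_neg (not_lt.2 g1.le), if_neg (not_lt.2 g2.le), e1, e2])
        (hφ a b haL hbL hab).2 (hφ a b' haL hbL' hab').2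
        (hOr a haL b hbL hab) (hOr a haL b' hbL' hab') (hOr b hbL b' hbL' hne)
        op op'
        (hτ a b ha hb).1 (hτ a b ha hb).2 (hτ a b' ha hb').1 (hτ a b' ha hb').2
      refine ⟨this.1, fun h => this.2 (hQ3 _ _ _ ?_)⟩
      have e : ({a, b, b'} : Finset PP) = {b, b', a} := (perm_b _ _ _).trans (perm_a _ _ _)
      rw [← e]; exact h
    · intro s _ hsX hq
      obtain ⟨a, ha, hlt⟩ := (hQ s hq (-T)).1
      exact lt_irrefl _ (hlt.trans (mX a (hsX ha)).2)
    · intro s _ hsY hq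
      obtain ⟨a, ha, hlt⟩ := (hQ s hq (-T)).2
      exact lt_irrefl _ (hlt.trans (mY a (hsY ha)).2)
  refine key.trans (arith_lemma _ _ _ ?_)
  rw [← Finset.card_union_of_disjoint]
  · exact Finset.card_le_card (Finset.union_subset (Finset.filter_subset _ _)
      (Finset.filter_subset _ _))
  · rw [Finset.disjoint_left]
    exact fun a ha hb => hXY a ha a hb rfl

/-- Extended dual Lovász Lemma: Let `Λ` be a family of `n` pseudoplanes in
general position in ℝ³ and `k` a nonnegative integer. Let `γ₀` be the bi-infinite x-monotone
curve `{(x, u x, v x) : x ∈ ℝ}` with `u, v` continuous, such that (1) `γ₀` intersects each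
pseudoplane of `Λ` in exactly one point, and (2) the xy-projection of `γ₀` intersects the
xy-projection of every intersection curve `γ_{a,b}` at most once. Then `γ₀` is fully
contained in at most `n(n−1)/2` corridors of `C^k`. -/
theorem statement7 (Λ : Finset PP) (n k : ℕ) (hn : Λ.card = n) (hΛ : PseudoplaneFamily Λ)
    (u v : ℝ → ℝ) (hu : Continuous u) (hv : Continuous v)
    (h1 : ∀ a ∈ Λ, ∃! x : ℝ, v x = a x (u x))
    (h2 : ∀ a ∈ Λ, ∀ b ∈ Λ, a ≠ b → ∀ φ : ℝ → ℝ, IsGraphFun a b φ →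
      {x : ℝ | u x = φ x}.Subsingleton) :
    ((kCorridors Λ k).filter fun s =>
        {p : ℝ × ℝ × ℝ | ∃ x : ℝ, p = (x, u x, v x)} ⊆ corridorSet s).card
      ≤ n * (n - 1) / 2 := by
  subst hn
  exact main_bound Λ k hΛ u v hu hv h1 h2
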